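/- Let r₀, E₀ > 0 and D₀ > 1. There exists a constant c > 0, depending only on r₀, E₀, D₀, such that for every Lipschitz cavity C with parameters r₀, E₀, D₀ and every continuously differentiable u : Ω → ℝ³ on Ω = ℝ³₋ \ C̄ with ∫_Ω |u|²/(1+|x|²) dx < ∞ and ∫_Ω |∇u|² dx < ∞, one has ∫_Ω |∇u(x)|² dx ≤ c ∫_Ω |∇̂u(x)|² dx, where ∇̂u = (∇u + (∇u)ᵀ)/2. -/

import Mathlib

open MeasureTheory Metric Set

noncomputable section

abbrev E3 := EuclideanSpace ℝ (Fin 3)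
abbrev E2 := EuclideanSpace ℝ (Fin 2)

/-- The open lower half-space `{x : x₃ < 0}`. -/
def lowerHalf : Set E3 := {x | x 2 < 0}

/-- The lower half-ball `B⁻_r(0) = {|x| < r, x₃ < 0}`. -/
def negBall (r : ℝ) : Set E3 := {x | ‖x‖ < r ∧ x 2 < 0}

/-- Jacobian matrix of a vector field: `(jac u x) i j = ∂uᵢ/∂xⱼ (x)`. -/
def jac (u : E3 → E3) (x : E3) : Matrix (Fin 3) (Fin 3) ℝ :=
  fun i j => fderiv ℝ u x (EuclideanSpace.single j 1) i

/-- Symmetric part of the Jacobian (strain tensor) `∇̂u`. -/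
def strain (u : E3 → E3) (x : E3) : Matrix (Fin 3) (Fin 3) ℝ :=
  fun i j => (jac u x i j + jac u x j i) / 2

/-- Squared Frobenius norm of a 3×3 matrix. -/
def frob2 (M : Matrix (Fin 3) (Fin 3) ℝ) : ℝ := ∑ i, ∑ j, (M i j)^2

/-- Divergence of a vector field. -/
def divg (u : E3 → E3) (x : E3) : ℝ := ∑ i, jac u x i i

/-- Projection on the first two coordinates. -/
def proj12 (x : E3) : E2 :=
  (x 0) • EuclideanSpace.single 0 1 + (x 1) • EuclideanSpace.single 1 1

/-- Embedding of the plane `{x₃ = 0}` into `ℝ³`: `x' ↦ (x'₁, x'₂, 0)`. -/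
def emb2 (x' : E2) : E3 :=
  (x' 0) • EuclideanSpace.single 0 1 + (x' 1) • EuclideanSpace.single 1 1

/-- Partial derivative of a scalar field in the k-th coordinate direction. -/
def pd (f : E3 → ℝ) (k : Fin 3) (x : E3) : ℝ := fderiv ℝ f x (EuclideanSpace.single k 1)

/-- `S` has boundary of Lipschitz class with constants r₀, E₀: at each boundary point `P`,
after a rigid change of coordinates sending `P` to `0`, the set is locally the open
epigraph of a Lipschitz function `ψ` with `ψ 0 = 0` and Lipschitz constant at most `E₀`. -/
def HasLipschitzBoundary (r₀ E₀ : ℝ) (S : Set E3) : Prop :=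
  ∀ P ∈ frontier S, ∃ (φ : E3 ≃ᵢ E3) (ψ : E2 → ℝ),
    φ P = 0 ∧ ψ 0 = 0 ∧ LipschitzOnWith (Real.toNNReal E₀) ψ (Metric.ball 0 r₀) ∧
    (φ '' S) ∩ Metric.ball 0 r₀ = {x ∈ Metric.ball (0 : E3) r₀ | ψ (proj12 x) < x 2}

/-- `S` has boundary of class C³ with constants r₀, E₀. -/
def HasC3Boundary (r₀ E₀ : ℝ) (S : Set E3) : Prop :=
  ∀ P ∈ frontier S, ∃ (φ : E3 ≃ᵢ E3) (ψ : E2 → ℝ),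
    φ P = 0 ∧ ψ 0 = 0 ∧ ContDiff ℝ 3 ψ ∧ fderiv ℝ ψ 0 = 0 ∧
    (∀ x' ∈ Metric.ball (0 : E2) r₀, ∀ k : ℕ, k ≤ 3 → ‖iteratedFDeriv ℝ k ψ x'‖ ≤ E₀) ∧
    (φ '' S) ∩ Metric.ball 0 r₀ = {x ∈ Metric.ball (0 : E3) r₀ | ψ (proj12 x) < x 2}

/-- Geometric a priori assumptions on a cavity: bounded open set, closure inside the lower
half-space, connected complement in the half-space, contained in `B⁻_{2D₀}(0)`, at distance
at least `D₀` from the plane `{x₃ = 0}`, with diameter less than `D₀`. -/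
def IsCavity (D₀ : ℝ) (C : Set E3) : Prop :=
  IsOpen C ∧ Bornology.IsBounded C ∧ closure C ⊆ lowerHalf ∧
  IsConnected (lowerHalf \ closure C) ∧ C ⊆ negBall (2*D₀) ∧
  (∀ x ∈ C, x 2 ≤ -D₀) ∧ Metric.diam C < D₀

/-- Lipschitz cavity with parameters r₀, E₀, D₀. -/
def IsLipschitzCavity (r₀ E₀ D₀ : ℝ) (C : Set E3) : Prop :=
  IsCavity D₀ C ∧ HasLipschitzBoundary r₀ E₀ C

/-- C³ cavity with parameters r₀, E₀, D₀. -/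
def IsC3Cavity (r₀ E₀ D₀ : ℝ) (C : Set E3) : Prop :=
  IsCavity D₀ C ∧ HasC3Boundary r₀ E₀ C

/-- Korn-type inequality in `ℝ³₋ \ C̄`. -/
abbrev ee (k : Fin 3) : E3 := EuclideanSpace.single k 1

lemma pd_continuous {f : E3 → ℝ} (hf : ContDiff ℝ 1 f) (k : Fin 3) : Continuous (pd f k) := by
  unfold pd
  exact (hf.continuous_fderiv (by norm_num)).clm_apply continuous_const

lemma pd_compact {f : E3 → ℝ} (hf : HasCompactSupport f) (k : Fin 3) :
    HasCompactSupport (pd f k) := by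
  unfold pd
  exact hf.fderiv_apply (𝕜 := ℝ) _

lemma conv_deriv {f g : E3 → ℝ} (hf : Continuous f)
    (hg : ContDiff ℝ 1 g) (hgc : HasCompactSupport g) (k : Fin 3) (x : E3) :
    fderiv ℝ (fun x => ∫ t, f t * g (x - t)) x (ee k) = ∫ t, f t * pd g k (x - t) := by
  have h := hgc.hasFDerivAt_convolution_right (ContinuousLinearMap.mul ℝ ℝ) (μ := volume)
    (hf.locallyIntegrable) hg x
  have h2 := h.fderiv
  have h3 : (fun x => ∫ t, f t * g (x - t)) =
    (convolution f g (ContinuousLinearMap.mul ℝ ℝ) volume) := by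
    ext x; simp [convolution]
  rw [h3, h2, convolution_precompR_apply]
  · simp [convolution, pd]
  · exact hf.locallyIntegrable
  · exact hgc.fderiv (𝕜 := ℝ)
  · exact hg.continuous_fderiv (by norm_num)

lemma conv_swap (f g : E3 → ℝ) (x : E3) :
    (∫ t, f t * g (x - t)) = ∫ t, g t * f (x - t) := by
  rw [← integral_sub_left_eq_self _ volume x]
  simp [mul_comm]

lemma pd_symm {f g : E3 → ℝ} (hf : ContDiff ℝ 1 f) (hfc : HasCompactSupport f)
    (hg : ContDiff ℝ 1 g) (hgc : HasCompactSupport g) (i j : Fin 3) :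
    (∫ x, pd f i x * pd g j x) = ∫ x, pd f j x * pd g i x := by
  set g' : E3 → ℝ := fun x => g (-x)
  have hg' : ContDiff ℝ 1 g' := hg.comp contDiff_neg
  have hgc' : HasCompactSupport g' := hgc.comp_homeomorph (Homeomorph.neg E3)
  have hpd : ∀ k x, pd g' k (0 - x) = - pd g k x := by
    intro k x
    have : HasFDerivAt g' ((fderiv ℝ g (- -x)).comp (-ContinuousLinearMap.id ℝ E3)) (-x) := by
      have h1 := ((hg.differentiable (by norm_num)) (- -x)).hasFDerivAt
      exact h1.comp (-x) ((hasFDerivAt_id (-x)).neg)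
    simp [pd, this.fderiv]
  have key : ∀ i j x, (∫ t, pd f i t * pd g' j (x - t)) =
      fderiv ℝ (fun x => fderiv ℝ (fun x => ∫ t, f t * g' (x - t)) x (ee j)) x (ee i) := by
    intro i j x
    have h1 : (fun x => fderiv ℝ (fun x => ∫ t, f t * g' (x - t)) x (ee j)) =
        fun x => ∫ t, pd g' j t * f (x - t) := by
      ext x
      rw [conv_deriv hf.continuous hg' hgc', conv_swap]
    rw [h1, conv_deriv (pd_continuous hg' j) hf hfc, conv_swap]
  have key2 : ∀ i j x, (∫ t, pd f j t * pd g' i (x - t)) =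
      fderiv ℝ (fun x => fderiv ℝ (fun x => ∫ t, f t * g' (x - t)) x (ee j)) x (ee i) := by
    intro i j x
    have h1 : (fun x => fderiv ℝ (fun x => ∫ t, f t * g' (x - t)) x (ee j)) =
        fun x => ∫ t, pd f j t * g' (x - t) := by
      ext x
      have h2 : (fun x => ∫ t, f t * g' (x - t)) = fun x => ∫ t, g' t * f (x - t) := by
        ext x; exact conv_swap _ _ _
      rw [h2, conv_deriv hg'.continuous hf hfc, conv_swap]
    rw [h1, conv_deriv (pd_continuous hf j) hg' hgc']
  have h := (key i j 0).trans (key2 i j 0).symm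
  simp only [hpd, mul_neg, integral_neg] at h
  linarith

lemma cint {f : E3 → ℝ} (hf : Continuous f) (hc : HasCompactSupport f) : Integrable f :=
  hf.integrable_of_hasCompactSupport hc

/-- Korn's first inequality. -/
lemma korn_first (V : Fin 3 → E3 → ℝ) (hV : ∀ i, ContDiff ℝ 1 (V i))
    (hc : ∀ i, HasCompactSupport (V i)) :
    (∫ x, ∑ i, ∑ j, (pd (V i) j x)^2) ≤
      2 * ∫ x, ∑ i, ∑ j, ((pd (V i) j x + pd (V j) i x)/2)^2 := by
  have hI : ∀ i j k l, Integrable (fun x => pd (V i) j x * pd (V k) l x) := fun i j k l =>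
    cint ((pd_continuous (hV i) j).mul (pd_continuous (hV k) l)) (pd_compact (hc i) j).mul_right
  have h1 : (∫ x, ∑ i, ∑ j, (pd (V i) j x)^2) = ∑ i, ∑ j, ∫ x, pd (V i) j x * pd (V i) j x := by
    rw [integral_finsetSum _ (fun i _ => integrable_finsetSum _ (fun j _ => by
      simpa [sq] using hI i j i j))]
    refine Finset.sum_congr rfl (fun i _ => ?_)
    rw [integral_finsetSum _ (fun j _ => by simpa [sq] using hI i j i j)]
    simp [sq]
  have h2 : (∫ x, ∑ i, ∑ j, ((pd (V i) j x + pd (V j) i x)/2)^2) =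
      (1/2) * (∫ x, ∑ i, ∑ j, (pd (V i) j x)^2) + (1/2) * ∑ i, ∑ j, ∫ x, pd (V i) j x * pd (V j) i x := by
    have : ∀ x, ∑ i, ∑ j, ((pd (V i) j x + pd (V j) i x)/2)^2 =
      (1/2) * (∑ i, ∑ j, (pd (V i) j x * pd (V i) j x)) + (1/2) * ∑ i, ∑ j, pd (V i) j x * pd (V j) i x := by
      intro x; simp only [Fin.sum_univ_three]; ring
    simp only [this]
    rw [integral_add, integral_const_mul, integral_const_mul]
    · congr 2
      · simp [sq]
      · rw [integral_finsetSum _ (fun i _ => integrable_finsetSum _ (fun j _ => hI i j j i))]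
        refine Finset.sum_congr rfl (fun i _ => ?_)
        rw [integral_finsetSum _ (fun j _ => hI i j j i)]
    · exact (integrable_finsetSum _ (fun i _ => integrable_finsetSum _ (fun j _ => hI i j i j))).const_mul _
    · exact (integrable_finsetSum _ (fun i _ => integrable_finsetSum _ (fun j _ => hI i j j i))).const_mul _
  have h3 : 0 ≤ ∑ i, ∑ j, ∫ x, pd (V i) j x * pd (V j) i x := by
    have : ∑ i, ∑ j, ∫ x, pd (V i) j x * pd (V j) i x = ∫ x, (∑ i, pd (V i) i x)^2 := by
      have e : ∀ x, (∑ i, pd (V i) i x)^2 = ∑ i, ∑ j, pd (V i) i x * pd (V j) j x := by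
        intro x; simp only [Fin.sum_univ_three]; ring
      simp only [e]
      rw [integral_finsetSum _ (fun i _ => integrable_finsetSum _ (fun j _ => hI i i j j))]
      refine Finset.sum_congr rfl (fun i _ => ?_)
      rw [integral_finsetSum _ (fun j _ => hI i i j j)]
      refine Finset.sum_congr rfl (fun j _ => ?_)
      exact pd_symm (hV i) (hc i) (hV j) (hc j) j i
    rw [this]
    exact integral_nonneg (fun x => sq_nonneg _)
  rw [h2]; linarith

lemma ibp {f g : E3 → ℝ} (hf : ContDiff ℝ 1 f) (hfc : HasCompactSupport f)
    (hg : ContDiff ℝ 1 g) (k : Fin 3) :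
    (∫ x, pd f k x * g x) = - ∫ x, f x * pd g k x := by
  have := integral_mul_fderiv_eq_neg_fderiv_mul_of_integrable (μ := volume) (f := f) (g := g) (v := ee k)
    (cint ((pd_continuous hf k).mul hg.continuous) (pd_compact hfc k).mul_right)
    (cint (hf.continuous.mul (pd_continuous hg k)) hfc.mul_right)
    (cint (hf.continuous.mul hg.continuous) hfc.mul_right)
    (fun x _ => hf.differentiable (by norm_num) x) (fun x _ => hg.differentiable (by norm_num) x)
  unfold pd
  linarith

lemma sq_lintegral_le {α : Type*} [MeasurableSpace α] (μ : Measure α) {f : α → ENNReal}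
    (hf : AEMeasurable f μ) : (∫⁻ x, f x ∂μ)^2 ≤ μ univ * ∫⁻ x, (f x)^2 ∂μ := by
  have h := ENNReal.lintegral_mul_le_Lp_mul_Lq μ Real.HolderConjugate.two_two hf
    (aemeasurable_const (b := (1:ENNReal)))
  simp only [Pi.mul_apply, mul_one, ENNReal.one_rpow, lintegral_const, one_mul] at h
  have h2 : (∫⁻ x, f x ∂μ)^2 ≤ ((∫⁻ x, (f x)^(2:ℝ) ∂μ)^((1:ℝ)/2) * (μ univ)^((1:ℝ)/2))^2 := by
    gcongr
  refine h2.trans (le_of_eq ?_)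
  rw [mul_pow, ← ENNReal.rpow_natCast, ← ENNReal.rpow_natCast, ← ENNReal.rpow_mul, ← ENNReal.rpow_mul]
  norm_num
  rw [mul_comm]

lemma lintegral_aff (g : E3 → ENNReal) (hg : Measurable g) (a : E3) {t : ℝ} (ht : 0 < t) :
    ∫⁻ y, g (a + t • y) = ENNReal.ofReal ((t^3)⁻¹) * ∫⁻ y, g y := by
  have h1 : ∫⁻ y, g (a + t • y) = ∫⁻ y, g (a + y) ∂(Measure.map (fun y : E3 => t • y) volume) := by
    rw [lintegral_map (by fun_prop) (by fun_prop)]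
  rw [h1]
  have := Measure.map_addHaar_smul (volume : Measure E3) ht.ne'
  rw [show (fun y : E3 => t • y) = (t • ·) from rfl, this]
  rw [lintegral_smul_measure, lintegral_add_left_eq_self]
  simp [abs_of_pos, ht, finrank_euclideanSpace]

lemma avg_bound (g : E3 → ENNReal) (hg : Measurable g) {B : Set E3} (hB : Convex ℝ B)
    (hm : MeasurableSet B) {t : ℝ} (ht : t ∈ Ioc (0:ℝ) 1) :
    ∫⁻ y in B, ∫⁻ p in B, g (p + t • (y - p)) ≤ 8 * volume B * ∫⁻ y in B, g y := by
  have key : ∀ s ∈ Icc (1/2:ℝ) 1, ∀ p ∈ B, ∫⁻ y in B, g ((1-s) • p + s • y) ≤ 8 * ∫⁻ y in B, g y := by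
    intro s hs p hp
    have hs0 : (0:ℝ) < s := by linarith [hs.1]
    calc ∫⁻ y in B, g ((1-s) • p + s • y) ≤ ∫⁻ y in B, B.indicator g ((1-s) • p + s • y) := by
          refine setLIntegral_mono' hm (fun y hy => ?_)
          rw [indicator_of_mem]
          exact hB hp hy (by linarith [hs.2]) hs0.le (by ring)
      _ ≤ ∫⁻ y, B.indicator g ((1-s) • p + s • y) := setLIntegral_le_lintegral _ _
      _ = ENNReal.ofReal ((s^3)⁻¹) * ∫⁻ y, B.indicator g y :=
          lintegral_aff _ (hg.indicator hm) _ hs0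
      _ ≤ 8 * ∫⁻ y in B, g y := by
          rw [lintegral_indicator hm]
          gcongr
          rw [show (8:ENNReal) = ENNReal.ofReal 8 by simp]
          apply ENNReal.ofReal_le_ofReal
          have : (1/2:ℝ)^3 ≤ s^3 := by gcongr; exact hs.1
          calc (s^3)⁻¹ ≤ ((1/2:ℝ)^3)⁻¹ := by gcongr
            _ = 8 := by norm_num
  rcases le_total (1/2) t with h | h
  · rw [lintegral_lintegral_swap (by fun_prop)]
    calc _ ≤ ∫⁻ p in B, 8 * ∫⁻ y in B, g y := by
          refine setLIntegral_mono' hm (fun p hp => ?_)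
          refine le_trans (le_of_eq ?_) (key t ⟨h, ht.2⟩ p hp)
          congr 1; ext y; congr 1; module
      _ = _ := by rw [setLIntegral_const]; ring
  · calc _ ≤ ∫⁻ p in B, 8 * ∫⁻ y in B, g y := by
          refine setLIntegral_mono' hm (fun p hp => ?_)
          refine le_trans (le_of_eq ?_) (key (1-t) ⟨by linarith, by linarith [ht.1]⟩ p hp)
          congr 1; ext y; congr 1; module
      _ = _ := by rw [setLIntegral_const]; ring

def SS (U : Fin 3 → E3 → ℝ) (p y : E3) : ℝ := ∑ j, (y j - p j) * (U j y - U j p)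
def sy (U : Fin 3 → E3 → ℝ) (i j : Fin 3) (x : E3) : ℝ := (pd (U i) j x + pd (U j) i x)/2
def sq2 (U : Fin 3 → E3 → ℝ) (x : E3) : ℝ := ∑ i, ∑ j, (sy U i j x)^2

lemma sy_cont {U : Fin 3 → E3 → ℝ} (hU : ∀ i, ContDiff ℝ 1 (U i)) (i j : Fin 3) :
    Continuous (sy U i j) := by
  unfold sy
  exact ((pd_continuous (hU i) j).add (pd_continuous (hU j) i)).div_const _

lemma sq2_cont {U : Fin 3 → E3 → ℝ} (hU : ∀ i, ContDiff ℝ 1 (U i)) : Continuous (sq2 U) := by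
  unfold sq2
  exact continuous_finsetSum _ (fun i _ => continuous_finsetSum _ (fun j _ => (sy_cont hU i j).pow 2))

lemma sq2_nonneg (U : Fin 3 → E3 → ℝ) (x : E3) : 0 ≤ sq2 U x :=
  Finset.sum_nonneg (fun i _ => Finset.sum_nonneg (fun j _ => sq_nonneg _))

lemma fderiv_eq_sum (f : E3 → ℝ) (x v : E3) : fderiv ℝ f x v = ∑ j, v j * pd f j x := by
  have h : v = ∑ j, v j • ee j := by
    ext k; simp [ee, Finset.sum_apply, Pi.single_apply]
  conv_lhs => rw [h]
  simp [pd]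

lemma quad_bound (a : Fin 3 → Fin 3 → ℝ) (v : E3) :
    |∑ i, v i * ∑ j, v j * a i j| ≤ ‖v‖^2 * Real.sqrt (∑ i, ∑ j, ((a i j + a j i)/2)^2) := by
  have h1 : ∑ i, v i * ∑ j, v j * a i j = ∑ q : Fin 3 × Fin 3, (v q.1 * v q.2) * ((a q.1 q.2 + a q.2 q.1)/2) := by
    rw [Fintype.sum_prod_type]; simp only [Fin.sum_univ_three]; ring
  have h2 : ∑ i, ∑ j, ((a i j + a j i)/2)^2 = ∑ q : Fin 3 × Fin 3, ((a q.1 q.2 + a q.2 q.1)/2)^2 := by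
    rw [Fintype.sum_prod_type]
  have h3 := Finset.sum_mul_sq_le_sq_mul_sq Finset.univ (fun q : Fin 3 × Fin 3 => v q.1 * v q.2)
    (fun q => (a q.1 q.2 + a q.2 q.1)/2)
  have h4 : ∑ q : Fin 3 × Fin 3, (v q.1 * v q.2)^2 = (‖v‖^2)^2 := by
    rw [EuclideanSpace.real_norm_sq_eq, Fintype.sum_prod_type]; simp only [Fin.sum_univ_three]; ring
  rw [h1, h2]
  rw [h4] at h3
  apply abs_le_of_sq_le_sq _ (by positivity)
  rw [mul_pow, Real.sq_sqrt (by positivity)]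
  exact h3

lemma SS_bound {U : Fin 3 → E3 → ℝ} (hU : ∀ i, ContDiff ℝ 1 (U i)) {p y : E3} (h : ‖y - p‖ ≤ 4) :
    ‖SS U p y‖ₑ ≤ 16 * ∫⁻ t in Ioc (0:ℝ) 1, ENNReal.ofReal (Real.sqrt (sq2 U (p + t • (y - p)))) := by
  have hd : ∀ j, ∀ t : ℝ, HasDerivAt (fun t : ℝ => U j (p + t • (y - p)))
      (fderiv ℝ (U j) (p + t • (y-p)) (y-p)) t := by
    intro j t
    have h1 : HasDerivAt (fun t : ℝ => p + t • (y - p)) (y - p) t := by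
      simpa using ((hasDerivAt_id t).smul_const (y-p)).const_add p
    exact ((hU j).differentiable (by norm_num) _).hasFDerivAt.comp_hasDerivAt t h1
  have hS : HasDerivAt (fun t : ℝ => t) 1 0 := hasDerivAt_id _
  have hd2 : ∀ t ∈ uIcc (0:ℝ) 1, HasDerivAt (fun t : ℝ => ∑ j, (y j - p j) * U j (p + t • (y - p)))
      (∑ j, (y-p) j * ∑ k, (y-p) k * pd (U j) k (p + t • (y-p))) t := by
    intro t _
    have := HasDerivAt.fun_sum (u := Finset.univ) (fun j _ => (hd j t).const_mul (y j - p j))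
    simpa [fderiv_eq_sum] using this
  have hc : Continuous (fun t : ℝ => ∑ j, (y-p) j * ∑ k, (y-p) k * pd (U j) k (p + t • (y-p))) := by
    have : ∀ j k, Continuous (fun t : ℝ => pd (U j) k (p + t • (y-p))) := fun j k =>
      (pd_continuous (hU j) k).comp (by fun_prop)
    fun_prop
  have hI := intervalIntegral.integral_eq_sub_of_hasDerivAt hd2 (hc.intervalIntegrable 0 1)
  have hSS : SS U p y = ∫ t in (0:ℝ)..1, ∑ j, (y-p) j * ∑ k, (y-p) k * pd (U j) k (p + t • (y-p)) := by
    rw [hI]; simp [SS, Finset.sum_sub_distrib, mul_sub]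
  rw [hSS, intervalIntegral.integral_of_le zero_le_one]
  refine (enorm_integral_le_lintegral_enorm _).trans ?_
  rw [← lintegral_const_mul' _ _ (by norm_num)]
  refine lintegral_mono (fun t => ?_)
  rw [Real.enorm_eq_ofReal_abs, show (16:ENNReal) = ENNReal.ofReal 16 by simp, ← ENNReal.ofReal_mul (by norm_num)]
  apply ENNReal.ofReal_le_ofReal
  refine (quad_bound (fun j k => pd (U j) k (p + t • (y-p))) (y-p)).trans ?_
  have : ‖y-p‖^2 ≤ 16 := by nlinarith [norm_nonneg (y-p)]
  unfold sq2 sy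
  gcongr

def eta : ContDiffBump (0:E3) := ⟨1, 3/2, by norm_num, by norm_num⟩
def et (x : E3) : ℝ := eta x
lemma et_cd : ContDiff ℝ 1 et := eta.contDiff
lemma et_cs : HasCompactSupport et := eta.hasCompactSupport
lemma et_zero {x : E3} (hx : x ∉ ball (0:E3) 2) : et x = 0 := by
  apply eta.zero_of_le_dist
  simp only [mem_ball, not_lt] at hx
  show (3/2:ℝ) ≤ _
  linarith
lemma pd_et_zero {x : E3} (hx : x ∉ ball (0:E3) 2) (k : Fin 3) : pd et k x = 0 := by
  have : x ∉ tsupport et := by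
    have h : tsupport et = closedBall 0 (3/2) := eta.tsupport_eq
    rw [h]
    simp only [mem_ball, not_lt, mem_closedBall, not_le] at hx ⊢
    linarith
  have h2 : x ∉ tsupport (fderiv ℝ et) := fun h => this (tsupport_fderiv_subset ℝ h)
  simp [pd, image_eq_zero_of_notMem_tsupport h2]
lemma et_le (x : E3) : et x ≤ 1 := eta.le_one
lemma et_nn (x : E3) : 0 ≤ et x := eta.nonneg
lemma et_one {x : E3} (hx : x ∈ ball (0:E3) 1) : et x = 1 :=
  eta.one_of_mem_closedBall (ball_subset_closedBall hx)
lemma et_pos : 0 < ∫ x, et x := eta.integral_pos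
lemma pd_et_bound : ∃ K : ℝ, 0 ≤ K ∧ ∀ k x, |pd et k x| ≤ K := by
  have : ∀ k, ∃ K, ∀ x, ‖pd et k x‖ ≤ K := fun k =>
    (pd_compact et_cs k).exists_bound_of_continuous (pd_continuous et_cd k)
  choose K hK using this
  refine ⟨∑ k, |K k|, by positivity, fun k x => ?_⟩
  calc |pd et k x| ≤ K k := hK k x
    _ ≤ |K k| := le_abs_self _
    _ ≤ _ := Finset.single_le_sum (f := fun k => |K k|) (fun _ _ => abs_nonneg _) (Finset.mem_univ k)

def TT (U : Fin 3 → E3 → ℝ) (i : Fin 3) (y : E3) : ℝ := ∫ p, pd et i p * SS U p y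

lemma coord_cd (j : Fin 3) : ContDiff ℝ 1 (fun x : E3 => x j) := by fun_prop

lemma pd_coord (i j : Fin 3) (x : E3) : pd (fun x : E3 => x j) i x = if i = j then 1 else 0 := by
  have : (fun x : E3 => x j) = (EuclideanSpace.proj j : E3 →L[ℝ] ℝ) := rfl
  unfold pd
  rw [this, ContinuousLinearMap.fderiv]
  simp [eq_comm]

lemma TT_eq {U : Fin 3 → E3 → ℝ} (hU : ∀ i, ContDiff ℝ 1 (U i)) (i : Fin 3) (y : E3) :
    TT U i y = (∫ x, et x) * U i y + ∑ j, y j * (∫ p, et p * pd (U j) i p)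
      + ∑ j, ∫ p, pd et i p * (p j * U j p) := by
  have c1 := pd_continuous et_cd i
  have c2 := pd_compact et_cs i
  have I1 : ∀ {g : E3 → ℝ}, Continuous g → Integrable (fun p => pd et i p * g p) := fun hg =>
    cint (c1.mul hg) c2.mul_right
  have hc : ∀ j, Continuous (fun p : E3 => p j) := fun j => (coord_cd j).continuous
  have hu : ∀ j, Continuous (U j) := fun j => (hU j).continuous
  have e0 : (∫ p, pd et i p) = 0 := by
    have := ibp et_cd et_cs (contDiff_const (c := (1:ℝ))) i
    simpa [pd] using this
  have e1 : ∀ j, (∫ p, pd et i p * p j) = - if i = j then ∫ x, et x else 0 := by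
    intro j
    rw [ibp et_cd et_cs (coord_cd j) i]
    simp only [pd_coord]
    split_ifs <;> simp
  have e2 : ∀ j, (∫ p, pd et i p * U j p) = - ∫ p, et p * pd (U j) i p := fun j =>
    ibp et_cd et_cs (hU j) i
  have e : ∀ p, pd et i p * SS U p y = ∑ j, ((y j * U j y) * pd et i p - U j y * (pd et i p * p j)
      - y j * (pd et i p * U j p) + pd et i p * (p j * U j p)) := by
    intro p
    simp only [SS, Finset.mul_sum]
    refine Finset.sum_congr rfl (fun j _ => ?_)
    ring
  have J : ∀ j, Integrable (fun p => pd et i p) ∧ Integrable (fun p => pd et i p * p j) ∧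
      Integrable (fun p => pd et i p * U j p) ∧ Integrable (fun p => pd et i p * (p j * U j p)) :=
    fun j => ⟨cint c1 c2, I1 (hc j), I1 (hu j), I1 ((hc j).mul (hu j))⟩
  have e3 : ∀ j, (∫ p, ((y j * U j y) * pd et i p - U j y * (pd et i p * p j)
      - y j * (pd et i p * U j p) + pd et i p * (p j * U j p))) =
      U j y * (if i = j then ∫ x, et x else 0) + y j * (∫ p, et p * pd (U j) i p)
        + ∫ p, pd et i p * (p j * U j p) := by
    intro j
    obtain ⟨J1, J2, J3, J4⟩ := J j
    have A1 : Integrable (fun p => (y j * U j y) * pd et i p - U j y * (pd et i p * p j)) :=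
      (J1.const_mul _).sub (J2.const_mul _)
    have A2 : Integrable (fun p => (y j * U j y) * pd et i p - U j y * (pd et i p * p j)
      - y j * (pd et i p * U j p)) := A1.sub (J3.const_mul _)
    rw [integral_add A2 J4, integral_sub A1 (J3.const_mul _),
      integral_sub (J1.const_mul _) (J2.const_mul _), integral_const_mul, integral_const_mul,
      integral_const_mul, e0, e1, e2]
    ring
  unfold TT
  simp only [e]
  rw [integral_finsetSum _ (fun j _ => by
    obtain ⟨J1, J2, J3, J4⟩ := J j
    exact (((J1.const_mul _).sub (J2.const_mul _)).sub (J3.const_mul _)).add J4)]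
  simp only [e3]
  rw [Finset.sum_add_distrib, Finset.sum_add_distrib]
  simp [mul_comm]

lemma TT_bound : ∃ K : NNReal, ∀ U : Fin 3 → E3 → ℝ, (∀ i, ContDiff ℝ 1 (U i)) → ∀ i,
    ∫⁻ y in ball (0:E3) 2, ‖TT U i y‖ₑ^2 ≤ K * ∫⁻ y in ball (0:E3) 2, ENNReal.ofReal (sq2 U y) := by
  obtain ⟨K, hK0, hK⟩ := pd_et_bound
  set B := ball (0:E3) 2 with hB
  set vB := volume B with hvB
  have hvt : vB ≠ ⊤ := measure_ball_lt_top.ne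
  have hmB : MeasurableSet B := measurableSet_ball
  refine ⟨((ENNReal.ofReal K * 16)^2).toNNReal * (8 * vB.toNNReal * vB.toNNReal), fun U hU i => ?_⟩
  set g : E3 → ENNReal := fun x => ENNReal.ofReal (Real.sqrt (sq2 U x)) with hg
  have hgm : Measurable g := by
    have := (sq2_cont hU).measurable
    fun_prop
  have hg2 : ∀ x, g x ^ 2 = ENNReal.ofReal (sq2 U x) := by
    intro x
    rw [hg, ← ENNReal.ofReal_pow (Real.sqrt_nonneg _), Real.sq_sqrt (sq2_nonneg U x)]
  have h1 : ∀ y ∈ B, ‖TT U i y‖ₑ ≤ (ENNReal.ofReal K * 16) * ∫⁻ p in B, ∫⁻ t in Ioc (0:ℝ) 1, g (p + t • (y - p)) := by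
    intro y hy
    calc ‖TT U i y‖ₑ ≤ ∫⁻ p, ‖pd et i p * SS U p y‖ₑ := enorm_integral_le_lintegral_enorm _
      _ ≤ ∫⁻ p, B.indicator (fun p => (ENNReal.ofReal K * 16) * ∫⁻ t in Ioc (0:ℝ) 1, g (p + t • (y - p))) p := by
          refine lintegral_mono (fun p => ?_)
          by_cases hp : p ∈ B
          · rw [indicator_of_mem hp, enorm_mul, mul_assoc]
            gcongr
            · rw [Real.enorm_eq_ofReal_abs]
              exact ENNReal.ofReal_le_ofReal (hK i p)
            · apply SS_bound hU
              have a1 := mem_ball_zero_iff.1 hp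
              have a2 := mem_ball_zero_iff.1 hy
              exact (norm_sub_le _ _).trans (by linarith)
          · rw [indicator_of_notMem hp, pd_et_zero hp]; simp
      _ = _ := by
          rw [lintegral_indicator hmB, lintegral_const_mul' _ _ (by finiteness)]
  have hmeas : Measurable (fun q : (E3 × E3) × ℝ => g (q.1.2 + q.2 • (q.1.1 - q.1.2))) := by fun_prop
  have h2 : ∀ y, (∫⁻ p in B, ∫⁻ t in Ioc (0:ℝ) 1, g (p + t • (y - p)))^2 ≤
      vB * ∫⁻ p in B, ∫⁻ t in Ioc (0:ℝ) 1, (g (p + t • (y - p)))^2 := by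
    intro y
    have m1 : Measurable (fun q : E3 × ℝ => g (q.1 + q.2 • (y - q.1))) := by fun_prop
    refine (sq_lintegral_le _ ?_).trans ?_
    · exact (Measurable.lintegral_prod_right' (ν := volume.restrict (Ioc (0:ℝ) 1)) m1).aemeasurable
    · rw [Measure.restrict_apply_univ]
      gcongr with p
      refine (sq_lintegral_le _ (by fun_prop)).trans ?_
      simp
  calc ∫⁻ y in B, ‖TT U i y‖ₑ^2 
      ≤ ∫⁻ y in B, (ENNReal.ofReal K * 16)^2 * (vB * ∫⁻ p in B, ∫⁻ t in Ioc (0:ℝ) 1, (g (p + t • (y - p)))^2) := by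
        refine setLIntegral_mono' hmB (fun y hy => ?_)
        calc ‖TT U i y‖ₑ^2 ≤ (ENNReal.ofReal K * 16 * ∫⁻ p in B, ∫⁻ t in Ioc (0:ℝ) 1, g (p + t • (y - p)))^2 := by
              gcongr; exact h1 y hy
          _ = (ENNReal.ofReal K * 16)^2 * (∫⁻ p in B, ∫⁻ t in Ioc (0:ℝ) 1, g (p + t • (y - p)))^2 := by ring
          _ ≤ _ := by gcongr; exact h2 y
    _ = (ENNReal.ofReal K * 16)^2 * (vB * ∫⁻ y in B, ∫⁻ p in B, ∫⁻ t in Ioc (0:ℝ) 1, (g (p + t • (y - p)))^2) := by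
        rw [lintegral_const_mul' _ _ (by finiteness), lintegral_const_mul' _ _ hvt]
    _ = (ENNReal.ofReal K * 16)^2 * (vB * ∫⁻ t in Ioc (0:ℝ) 1, ∫⁻ y in B, ∫⁻ p in B, (g (p + t • (y - p)))^2) := by
        congr 2
        have : ∀ y, ∫⁻ p in B, ∫⁻ t in Ioc (0:ℝ) 1, (g (p + t • (y - p)))^2 =
            ∫⁻ t in Ioc (0:ℝ) 1, ∫⁻ p in B, (g (p + t • (y - p)))^2 := fun y =>
          lintegral_lintegral_swap (by fun_prop)
        simp only [this]
        rw [lintegral_lintegral_swap]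
        have m2 : Measurable (fun q : (E3 × ℝ) × E3 => (g (q.2 + q.1.2 • (q.1.1 - q.2)))^2) := by fun_prop
        exact (Measurable.lintegral_prod_right' (ν := volume.restrict B) m2).aemeasurable
    _ ≤ (ENNReal.ofReal K * 16)^2 * (vB * ∫⁻ t in Ioc (0:ℝ) 1, 8 * vB * ∫⁻ y in B, (g y)^2) := by
        refine mul_le_mul_right (mul_le_mul_right ?_ _) _
        refine setLIntegral_mono' measurableSet_Ioc (fun t ht => ?_)
        exact avg_bound (fun x => g x ^ 2) (by fun_prop) (convex_ball _ _) hmB ht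
    _ = _ := by
        rw [setLIntegral_const]
        simp only [hg2]
        push_cast
        rw [ENNReal.coe_toNNReal hvt, ENNReal.coe_toNNReal (by finiteness)]
        simp
        ring

lemma cpow2 {f : E3 → ℝ} (hf : Continuous f) : Continuous (fun x => f x ^ 2) := hf.pow 2

lemma ci2 {f : E3 → ℝ} (hf : Continuous f) (r : ℝ) : IntegrableOn f (ball (0:E3) r) :=
  (hf.continuousOn.integrableOn_compact (isCompact_closedBall 0 r)).mono_set ball_subset_closedBall

lemma sq_integral_le {α : Type*} [MeasurableSpace α] (μ : Measure α) [IsFiniteMeasure μ] {f : α → ℝ}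
    (hf : Integrable f μ) (hf2 : Integrable (fun x => f x ^2) μ) :
    (∫ x, f x ∂μ)^2 ≤ μ.real univ * ∫ x, (f x)^2 ∂μ := by
  rcases (measureReal_nonneg (μ := μ) (s := univ)).eq_or_lt with h | h
  · have : μ = 0 := by
      rw [← Measure.measure_univ_eq_zero]
      rwa [eq_comm, measureReal_eq_zero_iff] at h
    simp [this]
  · set v := μ.real univ with hv
    set I := ∫ x, f x ∂μ with hI
    have h1 : 0 ≤ ∫ x, (v * f x - I)^2 ∂μ := integral_nonneg (fun x => sq_nonneg _)
    have h2 : ∫ x, (v * f x - I)^2 ∂μ = v^2 * (∫ x, (f x)^2 ∂μ) - 2 * v * I * I + I^2 * v := by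
      have e : ∀ x, (v * f x - I)^2 = v^2 * (f x)^2 - 2 * v * I * f x + I^2 := fun x => by ring
      simp only [e]
      have a1 : Integrable (fun x => v^2 * (f x)^2 - 2 * v * I * f x) μ :=
        (hf2.const_mul _).sub (hf.const_mul _)
      rw [integral_add a1 (integrable_const _), integral_sub (hf2.const_mul _) (hf.const_mul _),
        integral_const_mul, integral_const_mul, integral_const]
      simp [← hI, ← hv, mul_comm]
    rw [h2] at h1
    have : 0 ≤ v * (v * (∫ x, (f x)^2 ∂μ) - I^2) := by linarith [h1]
    have := nonneg_of_mul_nonneg_right this h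
    linarith

lemma TT_eq' {U : Fin 3 → E3 → ℝ} (hU : ∀ i, ContDiff ℝ 1 (U i)) (i : Fin 3) :
    TT U i = fun y => (∫ x, et x) * U i y + ∑ j, y j * (∫ p, et p * pd (U j) i p)
      + ∑ j, ∫ p, pd et i p * (p j * U j p) := funext (TT_eq hU i)

lemma TT_cd {U : Fin 3 → E3 → ℝ} (hU : ∀ i, ContDiff ℝ 1 (U i)) (i : Fin 3) :
    ContDiff ℝ 1 (TT U i) := by
  rw [TT_eq' hU i]
  have := hU i
  have h2 : ContDiff ℝ 1 (fun y : E3 => ∑ j, y j * (∫ p, et p * pd (U j) i p)) :=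
    ContDiff.sum (fun j _ => (coord_cd j).mul contDiff_const)
  exact ((contDiff_const.mul this).add h2).add contDiff_const

lemma pd_TT {U : Fin 3 → E3 → ℝ} (hU : ∀ i, ContDiff ℝ 1 (U i)) (i j : Fin 3) (x : E3) :
    pd (TT U i) j x = (∫ x, et x) * pd (U i) j x + (∫ p, et p * pd (U j) i p) := by
  have d1 : HasFDerivAt (U i) (fderiv ℝ (U i) x) x := ((hU i).differentiable (by norm_num) x).hasFDerivAt
  have d2 : ∀ k, HasFDerivAt (fun y : E3 => y k) (EuclideanSpace.proj k : E3 →L[ℝ] ℝ) x := fun k =>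
    (EuclideanSpace.proj k : E3 →L[ℝ] ℝ).hasFDerivAt
  have := ((d1.const_mul (∫ x, et x)).add (HasFDerivAt.fun_sum (u := Finset.univ)
    (fun k _ => (d2 k).mul_const (∫ p, et p * pd (U k) i p)))).add_const
      (∑ j, ∫ p, pd et i p * (p j * U j p))
  have e := TT_eq' hU i
  unfold pd
  rw [e]
  erw [this.fderiv]
  simp [pd]

lemma TT_boundR : ∃ K : ℝ, 0 ≤ K ∧ ∀ U : Fin 3 → E3 → ℝ, (∀ i, ContDiff ℝ 1 (U i)) → ∀ i,
    ∫ y in ball (0:E3) 2, (TT U i y)^2 ≤ K * ∫ y in ball (0:E3) 2, sq2 U y := by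
  obtain ⟨K, hK⟩ := TT_bound
  refine ⟨K, K.coe_nonneg, fun U hU i => ?_⟩
  have h := hK U hU i
  have i2 := ci2 (sq2_cont hU) 2
  have i1 := ci2 (cpow2 (TT_cd hU i).continuous) 2
  rw [← ofReal_integral_eq_lintegral_ofReal i2 (ae_of_all _ (sq2_nonneg U))] at h
  have e : ∀ y, ‖TT U i y‖ₑ^2 = ENNReal.ofReal ((TT U i y)^2) := fun y => by
    rw [Real.enorm_eq_ofReal_abs, ← ENNReal.ofReal_pow (abs_nonneg _), sq_abs]
  simp only [e] at h
  rw [← ofReal_integral_eq_lintegral_ofReal i1 (ae_of_all _ (fun y => sq_nonneg _)),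
    ← ENNReal.ofReal_coe_nnreal, ← ENNReal.ofReal_mul K.coe_nonneg] at h
  exact (ENNReal.ofReal_le_ofReal_iff (mul_nonneg K.coe_nonneg (integral_nonneg (sq2_nonneg U)))).1 h

lemma pd_et_one {x : E3} (hx : x ∈ ball (0:E3) 1) (k : Fin 3) : pd et k x = 0 := by
  have : et =ᶠ[nhds x] fun _ => (1:ℝ) :=
    Filter.eventually_of_mem (isOpen_ball.mem_nhds hx) (fun y hy => et_one hy)
  simp [pd, this.fderiv_eq]

lemma unit_korn : ∃ K : ℝ, 0 ≤ K ∧ ∀ U : Fin 3 → E3 → ℝ, (∀ i, ContDiff ℝ 1 (U i)) →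
    ∃ M : Fin 3 → Fin 3 → ℝ, ∫ x in ball (0:E3) 1, ∑ i, ∑ j, (pd (U i) j x - M i j)^2 ≤
      K * ∫ y in ball (0:E3) 2, sq2 U y := by
  obtain ⟨KT, hKT0, hKT⟩ := TT_boundR
  obtain ⟨K1, hK10, hK1⟩ := pd_et_bound
  set m := ∫ x, et x with hm
  have hm0 : 0 < m := et_pos
  set B := ball (0:E3) 2 with hB
  set vB := (volume.restrict B).real univ with hvB
  have hv0 : 0 ≤ vB := measureReal_nonneg
  set KK := 4 * (m^2 + vB * vB + 2 * (K1^2 * KT)) with hKK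
  refine ⟨m⁻¹^2 * (2 * (9 * KK)), by positivity, fun U hU => ?_⟩
  set a : Fin 3 → Fin 3 → ℝ := fun i j => ∫ p, et p * pd (U j) i p with ha
  set S := ∫ y in B, sq2 U y with hS
  have hS0 : 0 ≤ S := integral_nonneg (sq2_nonneg U)
  have hW := TT_cd hU
  set W := TT U with hWd
  set V : Fin 3 → E3 → ℝ := fun i x => et x * W i x with hV
  have hVc : ∀ i, ContDiff ℝ 1 (V i) := fun i => et_cd.mul (hW i)
  have hVs : ∀ i, HasCompactSupport (V i) := fun i => et_cs.mul_right
  have hpdV : ∀ i j x, pd (V i) j x = et x * (m * pd (U i) j x + a i j) + pd et j x * W i x := by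
    intro i j x
    have d1 := (et_cd.differentiable (by norm_num) x)
    have d2 := ((hW i).differentiable (by norm_num) x)
    have h1 := d1.hasFDerivAt.mul d2.hasFDerivAt
    have h2 : pd (W i) j x = m * pd (U i) j x + a i j := pd_TT hU i j x
    rw [← h2]
    have h3 : pd (V i) j x = et x * pd (W i) j x + W i x * pd et j x := by
      unfold pd
      erw [h1.fderiv]
      simp
    rw [h3]; ring
  have hsyc := fun i j => sy_cont hU i j
  have hssq : ∀ i j x, (sy U i j x)^2 ≤ sq2 U x := by
    intro i j x
    unfold sq2
    refine (Finset.single_le_sum (f := fun j => (sy U i j x)^2) (fun _ _ => sq_nonneg _) (Finset.mem_univ j)).trans ?_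
    exact Finset.single_le_sum (f := fun i => ∑ j, (sy U i j x)^2)
      (fun _ _ => Finset.sum_nonneg (fun _ _ => sq_nonneg _)) (Finset.mem_univ i)
  have hsyS : ∀ i j, ∫ x in B, (sy U i j x)^2 ≤ S := fun i j =>
    integral_mono (ci2 (cpow2 (hsyc i j)) 2) (ci2 (sq2_cont hU) 2) (hssq i j)
  have has : ∀ i j, ((a i j + a j i)/2)^2 ≤ vB * S := by
    intro i j
    have e1 : (a i j + a j i)/2 = ∫ x in B, et x * sy U i j x := by
      have i1 : ∀ i j, Integrable (fun p => et p * pd (U j) i p) := fun i j =>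
        cint (et_cd.continuous.mul (pd_continuous (hU j) i)) et_cs.mul_right
      rw [setIntegral_eq_integral_of_forall_compl_eq_zero (fun x hx => by rw [et_zero hx, zero_mul]), ha]
      simp only
      rw [← integral_add (i1 i j) (i1 j i), ← integral_div]
      congr 1
      ext x; unfold sy; ring
    rw [e1]
    have c : Continuous (fun x => et x * sy U i j x) := et_cd.continuous.mul (hsyc i j)
    have : IsFiniteMeasure (volume.restrict B) := ⟨by
      rw [Measure.restrict_apply_univ]; exact measure_ball_lt_top⟩
    refine (sq_integral_le _ (ci2 c 2) (ci2 (cpow2 c) 2)).trans ?_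
    refine mul_le_mul_of_nonneg_left ?_ hv0
    refine le_trans (integral_mono (ci2 (cpow2 c) 2) (ci2 (cpow2 (hsyc i j)) 2) (fun x => ?_)) (hsyS i j)
    simp only [mul_pow]
    have h1 := et_le x
    have h2 := et_nn x
    have : et x ^ 2 ≤ 1 := by nlinarith
    nlinarith [sq_nonneg (sy U i j x)]
  have hsym : ∀ i j, ∫ x, ((pd (V i) j x + pd (V j) i x)/2)^2 ≤ KK * S := by
    intro i j
    rw [← setIntegral_eq_integral_of_forall_compl_eq_zero (s := B) (fun x hx => by
      rw [hpdV, hpdV, et_zero hx, pd_et_zero hx, pd_et_zero hx]; simp)]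
    have cc : Continuous (fun x => ((pd (V i) j x + pd (V j) i x)/2)^2) :=
      (((pd_continuous (hVc i) j).add (pd_continuous (hVc j) i)).div_const 2).pow 2
    have g1 := ci2 (cpow2 (hsyc i j)) 2
    have g2 := ci2 (continuous_const (y := ((a i j + a j i)/2)^2)) 2
    have g3 := fun i => ci2 (cpow2 (hW i).continuous) 2
    have hpt : ∀ x, ((pd (V i) j x + pd (V j) i x)/2)^2 ≤
        (((4*m^2) * (sy U i j x)^2 + 4 * ((a i j + a j i)/2)^2) + (4*K1^2) * (W i x)^2) + (4*K1^2) * (W j x)^2 := by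
      intro x
      have e : (pd (V i) j x + pd (V j) i x)/2 = et x * (m * sy U i j x) + et x * ((a i j + a j i)/2)
          + (pd et j x * W i x)/2 + (pd et i x * W j x)/2 := by
        rw [hpdV, hpdV]; unfold sy; ring
      rw [e]
      have h4 : ∀ p q r s : ℝ, (p+q+r+s)^2 ≤ 4*(p^2+q^2+r^2+s^2) := fun p q r s => by
        nlinarith [sq_nonneg (p-q), sq_nonneg (p-r), sq_nonneg (p-s), sq_nonneg (q-r), sq_nonneg (q-s), sq_nonneg (r-s)]
      refine (h4 _ _ _ _).trans ?_
      have h1 := et_le x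
      have h2 := et_nn x
      have he : et x ^ 2 ≤ 1 := by nlinarith
      have hk : ∀ k, (pd et k x)^2 ≤ K1^2 := fun k => sq_le_sq' (by linarith [neg_abs_le (pd et k x), hK1 k x]) ((le_abs_self _).trans (hK1 k x))
      have q1 : (et x * (m * sy U i j x))^2 ≤ m^2 * (sy U i j x)^2 := by
        rw [mul_pow, mul_pow]; exact mul_le_of_le_one_left (by positivity) he
      have q2 : (et x * ((a i j + a j i)/2))^2 ≤ ((a i j + a j i)/2)^2 := by
        rw [mul_pow]; exact mul_le_of_le_one_left (by positivity) he
      have q3 : ∀ k l, ((pd et k x * W l x)/2)^2 ≤ K1^2 * (W l x)^2 := by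
        intro k l
        have := mul_le_mul_of_nonneg_right (hk k) (sq_nonneg (W l x))
        rw [div_pow, mul_pow]
        nlinarith [mul_nonneg (sq_nonneg (pd et k x)) (sq_nonneg (W l x))]
      have := q3 j i
      have := q3 i j
      linarith
    have I1 := (g1.const_mul (4*m^2))
    have I2 := g2.const_mul 4
    have I3 := (g3 i).const_mul (4*K1^2)
    have I4 := (g3 j).const_mul (4*K1^2)
    have I12 : IntegrableOn (fun x => (4*m^2) * (sy U i j x)^2 + 4 * ((a i j + a j i)/2)^2) B := I1.add I2
    have I123 : IntegrableOn (fun x => ((4*m^2) * (sy U i j x)^2 + 4 * ((a i j + a j i)/2)^2) + (4*K1^2) * (W i x)^2) B := I12.add I3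
    refine (integral_mono (ci2 cc 2) (I123.add I4) hpt).trans ?_
    simp only [Pi.add_apply]
    rw [integral_add I123 I4, integral_add I12 I3, integral_add I1 I2, integral_const_mul, integral_const_mul,
      integral_const_mul, integral_const, ← hvB]
    have b1 := mul_le_mul_of_nonneg_left (hsyS i j) (by positivity : 0 ≤ 4*m^2)
    have b2 := mul_le_mul_of_nonneg_left (has i j) (by positivity : 0 ≤ 4*vB)
    have b3 := mul_le_mul_of_nonneg_left (hKT U hU i) (by positivity : 0 ≤ 4*K1^2)
    have b4 := mul_le_mul_of_nonneg_left (hKT U hU j) (by positivity : 0 ≤ 4*K1^2)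
    simp only [← hS, ← hWd] at b3 b4
    simp only [smul_eq_mul, integral_const_mul, ← hB]
    rw [hKK]
    nlinarith
  refine ⟨fun i j => - (m⁻¹ * a i j), ?_⟩
  have hVint : Integrable (fun x => ∑ i, ∑ j, (pd (V i) j x)^2) :=
    integrable_finsetSum _ (fun i _ => integrable_finsetSum _ (fun j _ => by
      refine cint (cpow2 (pd_continuous (hVc i) j)) ?_
      exact (pd_compact (hVs i) j).comp_left (g := fun t => t^2) (by simp)))
  have hVint2 : ∀ i j, Integrable (fun x => ((pd (V i) j x + pd (V j) i x)/2)^2) := fun i j => by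
    have c := (((pd_continuous (hVc i) j).add (pd_continuous (hVc j) i)).div_const 2).pow 2
    refine cint c ?_
    have := ((pd_compact (hVs i) j).add (pd_compact (hVs j) i))
    exact this.comp_left (g := fun t => (t/2)^2) (by simp)
  calc ∫ x in ball (0:E3) 1, ∑ i, ∑ j, (pd (U i) j x - - (m⁻¹ * a i j))^2
      = ∫ x in ball (0:E3) 1, m⁻¹^2 * ∑ i, ∑ j, (pd (V i) j x)^2 := by
        refine setIntegral_congr_fun measurableSet_ball (fun x hx => ?_)
        simp only [Finset.mul_sum]
        refine Finset.sum_congr rfl (fun i _ => Finset.sum_congr rfl (fun j _ => ?_))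
        rw [hpdV, et_one hx, pd_et_one hx]
        field_simp
        ring
    _ = m⁻¹^2 * ∫ x in ball (0:E3) 1, ∑ i, ∑ j, (pd (V i) j x)^2 := integral_const_mul _ _
    _ ≤ m⁻¹^2 * ∫ x, ∑ i, ∑ j, (pd (V i) j x)^2 := by
        refine mul_le_mul_of_nonneg_left ?_ (by positivity)
        exact setIntegral_le_integral hVint (ae_of_all _ (fun x => by positivity))
    _ ≤ m⁻¹^2 * (2 * ∫ x, ∑ i, ∑ j, ((pd (V i) j x + pd (V j) i x)/2)^2) := by
        refine mul_le_mul_of_nonneg_left (korn_first V hVc hVs) (by positivity)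
    _ ≤ m⁻¹^2 * (2 * (9 * KK * S)) := by
        refine mul_le_mul_of_nonneg_left (mul_le_mul_of_nonneg_left ?_ (by norm_num)) (by positivity)
        rw [integral_finsetSum _ (fun i _ => integrable_finsetSum _ (fun j _ => hVint2 i j))]
        simp only [integral_finsetSum _ (fun j _ => hVint2 _ j)]
        calc _ ≤ ∑ i : Fin 3, ∑ j : Fin 3, KK * S := Finset.sum_le_sum (fun i _ => Finset.sum_le_sum (fun j _ => hsym i j))
          _ = _ := by simp; ring
    _ = _ := by ring

abbrev FM := EuclideanSpace ℝ (Fin 3 × Fin 3)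
def GG (u : E3 → E3) (x : E3) : FM := WithLp.toLp 2 (fun q => jac u x q.1 q.2)
def eS (u : E3 → E3) (x : E3) : ENNReal := ENNReal.ofReal (frob2 (strain u x))

def LK {F : Type*} [NormedAddCommGroup F] (Ω : Set E3) (G : E3 → F) (e : E3 → ENNReal) (K : NNReal) : Prop :=
  ∀ x ρ, 0 < ρ → closedBall x (4*ρ) ⊆ Ω →
    ∃ M : F, ∫⁻ y in ball x ρ, ‖G y - M‖ₑ^2 ≤ K * ∫⁻ y in ball x (2*ρ), e y

lemma jac_meas (u : E3 → E3) (i j : Fin 3) : Measurable (fun x => jac u x i j) := by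
  unfold jac
  have := measurable_fderiv_apply_const ℝ u (EuclideanSpace.single j 1)
  have h2 : Continuous (fun x : E3 => x i) := (coord_cd i).continuous
  exact h2.measurable.comp this

lemma GG_meas (u : E3 → E3) : Measurable (GG u) := by
  unfold GG
  have h : Measurable (fun x => (fun q : Fin 3 × Fin 3 => jac u x q.1 q.2)) :=
    measurable_pi_lambda _ (fun q => jac_meas u q.1 q.2)
  exact (WithLp.measurable_toLp 2 (Fin 3 × Fin 3 → ℝ)).comp h

lemma strain_meas (u : E3 → E3) : Measurable (fun x => frob2 (strain u x)) := by
  unfold frob2 strain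
  have := jac_meas u
  fun_prop

lemma eS_meas (u : E3 → E3) : Measurable (eS u) := (strain_meas u).ennreal_ofReal

lemma GG_sub (u : E3 → E3) (x : E3) (M : FM) :
    ‖GG u x - M‖ₑ^2 = ENNReal.ofReal (∑ i, ∑ j, (jac u x i j - M (i,j))^2) := by
  rw [← ofReal_norm, ← ENNReal.ofReal_pow (norm_nonneg _), EuclideanSpace.norm_sq_eq,
    Fintype.sum_prod_type]
  simp [GG]

lemma GG_norm (u : E3 → E3) (x : E3) :
    ‖GG u x‖ₑ^2 = ENNReal.ofReal (frob2 (jac u x)) := by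
  have := GG_sub u x 0
  simpa [frob2] using this

lemma ball_aff (g : E3 → ENNReal) (hg : Measurable g) (x : E3) {ρ : ℝ} (hρ : 0 < ρ) (s : ℝ) :
    ∫⁻ y in ball (0:E3) s, g (x + ρ • y) = ENNReal.ofReal ((ρ^3)⁻¹) * ∫⁻ z in ball x (s*ρ), g z := by
  rw [← lintegral_indicator measurableSet_ball, ← lintegral_indicator measurableSet_ball,
    ← lintegral_aff _ (hg.indicator measurableSet_ball) x hρ]
  congr 1
  ext y
  have : y ∈ ball (0:E3) s ↔ x + ρ • y ∈ ball x (s*ρ) := by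
    simp only [mem_ball, dist_zero_right, dist_self_add_left, norm_smul, Real.norm_eq_abs, abs_of_pos hρ]
    rw [mul_comm, mul_lt_mul_iff_of_pos_right hρ]
  by_cases h : y ∈ ball (0:E3) s
  · rw [indicator_of_mem h, indicator_of_mem (this.1 h)]
  · rw [indicator_of_notMem h, indicator_of_notMem (fun h' => h (this.2 h'))]

lemma unit_korn' : ∃ K : NNReal, ∀ U : Fin 3 → E3 → ℝ, (∀ i, ContDiff ℝ 1 (U i)) →
    ∃ M : Fin 3 → Fin 3 → ℝ, ∫⁻ x in ball (0:E3) 1, ENNReal.ofReal (∑ i, ∑ j, (pd (U i) j x - M i j)^2) ≤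
      K * ∫⁻ y in ball (0:E3) 2, ENNReal.ofReal (sq2 U y) := by
  obtain ⟨K, hK0, hK⟩ := unit_korn
  refine ⟨K.toNNReal, fun U hU => ?_⟩
  obtain ⟨M, hM⟩ := hK U hU
  refine ⟨M, ?_⟩
  have c : Continuous (fun x => ∑ i, ∑ j, (pd (U i) j x - M i j)^2) :=
    continuous_finsetSum _ (fun i _ => continuous_finsetSum _ (fun j _ =>
      ((pd_continuous (hU i) j).sub continuous_const).pow 2))
  rw [← ofReal_integral_eq_lintegral_ofReal (ci2 (sq2_cont hU) 2) (ae_of_all _ (sq2_nonneg U)),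
    ← ofReal_integral_eq_lintegral_ofReal (ci2 c 1) (ae_of_all _ (fun x => by positivity)),
    show ((K.toNNReal : NNReal) : ENNReal) = ENNReal.ofReal K from rfl, ← ENNReal.ofReal_mul hK0]
  exact ENNReal.ofReal_le_ofReal hM

lemma LK_korn : ∃ K : NNReal, ∀ (Ω : Set E3) (u : E3 → E3), IsOpen Ω → ContDiffOn ℝ 1 u Ω →
    LK Ω (GG u) (eS u) K := by
  obtain ⟨K, hK⟩ := unit_korn'
  refine ⟨K, fun Ω u hΩ hu x ρ hρ hx => ?_⟩
  let χ : ContDiffBump x := ⟨2*ρ, 4*ρ, by linarith, by linarith⟩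
  set v : E3 → E3 := fun y => χ y • u y with hv
  have hvc : ContDiff ℝ 1 v := by
    rw [contDiff_iff_contDiffAt]
    intro y
    by_cases hy : y ∈ Ω
    · exact (χ.contDiff.contDiffAt).smul (hu.contDiffAt (hΩ.mem_nhds hy))
    · have h1 : y ∉ tsupport χ := by rw [χ.tsupport_eq]; exact fun h => hy (hx h)
      have h2 : y ∉ tsupport v := fun h => h1 (tsupport_smul_subset_left _ _ h)
      have := notMem_tsupport_iff_eventuallyEq.1 h2
      exact (contDiffAt_const (c := (0:E3))).congr_of_eventuallyEq this
  have hjac : ∀ y ∈ ball x (2*ρ), jac v y = jac u y := by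
    intro y hy
    have : v =ᶠ[nhds y] u := by
      refine Filter.eventually_of_mem (isOpen_ball.mem_nhds hy) (fun z hz => ?_)
      simp only [hv]
      rw [χ.one_of_mem_closedBall (ball_subset_closedBall hz), one_smul]
    unfold jac
    rw [this.fderiv_eq]
  set U : Fin 3 → E3 → ℝ := fun i y => ρ⁻¹ * (v (x + ρ • y)) i with hUd
  have hU : ∀ i, ContDiff ℝ 1 (U i) := by
    intro i
    have h1 : ContDiff ℝ 1 (fun y : E3 => x + ρ • y) := by fun_prop
    exact contDiff_const.mul ((coord_cd i).comp (hvc.comp h1))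
  have hpd : ∀ i j y, pd (U i) j y = jac v (x + ρ • y) i j := by
    intro i j y
    have h1 : HasFDerivAt (fun y : E3 => x + ρ • y) (ρ • ContinuousLinearMap.id ℝ E3) y :=
      ((hasFDerivAt_id y).const_smul ρ).const_add x
    have h2 := (hvc.differentiable (by norm_num) (x + ρ • y)).hasFDerivAt
    have h3 := ((EuclideanSpace.proj i : E3 →L[ℝ] ℝ).hasFDerivAt (x := v (x + ρ • y))).comp y (h2.comp y h1)
    have h4 := h3.const_mul ρ⁻¹
    unfold pd
    have h5 : fderiv ℝ (U i) y = _ := h4.fderiv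
    rw [h5]
    simp [jac]
    field_simp
  obtain ⟨M, hM⟩ := hK U hU
  refine ⟨WithLp.toLp 2 (fun q => M q.1 q.2), ?_⟩
  set MM : FM := WithLp.toLp 2 (fun q => M q.1 q.2) with hMM
  have e1 : ∫⁻ y in ball (0:E3) 1, ENNReal.ofReal (∑ i, ∑ j, (pd (U i) j y - M i j)^2) =
      ∫⁻ y in ball (0:E3) 1, (fun z => ‖GG u z - MM‖ₑ^2) (x + ρ • y) := by
    refine setLIntegral_congr_fun measurableSet_ball (fun y hy => ?_)
    have hy2 : x + ρ • y ∈ ball x (2*ρ) := by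
      simp only [mem_ball, dist_zero_right, dist_self_add_left, norm_smul, Real.norm_eq_abs, abs_of_pos hρ] at hy ⊢
      nlinarith
    simp only [GG_sub, hpd, hjac _ hy2, hMM]
  have e2 : ∫⁻ y in ball (0:E3) 2, ENNReal.ofReal (sq2 U y) =
      ∫⁻ y in ball (0:E3) 2, (eS u) (x + ρ • y) := by
    refine setLIntegral_congr_fun measurableSet_ball (fun y hy => ?_)
    have hy2 : x + ρ • y ∈ ball x (2*ρ) := by
      simp only [mem_ball, dist_zero_right, dist_self_add_left, norm_smul, Real.norm_eq_abs, abs_of_pos hρ] at hy ⊢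
      nlinarith
    simp only [eS, sq2, sy, hpd, hjac _ hy2, frob2, strain]
  have hm : Measurable (fun z => ‖GG u z - MM‖ₑ^2) := by
    have := GG_meas u
    fun_prop
  rw [e1, e2, ball_aff _ hm x hρ, ball_aff _ (eS_meas u) x hρ, one_mul] at hM
  have hc0 : ENNReal.ofReal ((ρ^3)⁻¹) ≠ 0 := by
    rw [Ne, ENNReal.ofReal_eq_zero, not_le]; positivity
  rw [mul_left_comm] at hM
  exact (ENNReal.mul_le_mul_iff_right hc0 ENNReal.ofReal_ne_top).1 hM

lemma esq (a : FM) : ‖a‖ₑ^2 = ENNReal.ofReal (‖a‖^2) := by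
  rw [← ofReal_norm, ENNReal.ofReal_pow (norm_nonneg _)]

lemma enorm_sq_eps (a b c : FM) {ε : ℝ} (hε : 0 < ε) :
    ‖a - c‖ₑ^2 ≤ ENNReal.ofReal (1+ε) * ‖b - c‖ₑ^2 + ENNReal.ofReal (1+ε⁻¹) * ‖a - b‖ₑ^2 := by
  rw [esq, esq, esq, ← ENNReal.ofReal_mul (by positivity), ← ENNReal.ofReal_mul (by positivity),
    ← ENNReal.ofReal_add (by positivity) (by positivity)]
  apply ENNReal.ofReal_le_ofReal
  have h : ‖a - c‖ ≤ ‖b - c‖ + ‖a - b‖ := by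
    have : a - c = (b - c) + (a - b) := by abel
    rw [this]; exact norm_add_le _ _
  have h0 := norm_nonneg (a - c)
  set p := ‖b - c‖
  set q := ‖a - b‖
  have h1 : ‖a - c‖^2 ≤ (p+q)^2 := by gcongr
  have h2 : ε⁻¹ * (ε * p - q)^2 = ε * p^2 - 2 * p * q + ε⁻¹ * q^2 := by field_simp; ring
  have h3 : 0 ≤ ε⁻¹ * (ε * p - q)^2 := by positivity
  nlinarith

lemma enorm_sq_tri (a b c : FM) : ‖a - c‖ₑ^2 ≤ 2 * ‖a - b‖ₑ^2 + 2 * ‖c - b‖ₑ^2 := by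
  have := enorm_sq_eps a b c one_pos
  have e : ENNReal.ofReal (1+1) = 2 := by norm_num
  rw [inv_one, e, ← enorm_neg (b - c), neg_sub, add_comm] at this
  exact this

lemma vol_ball (y : E3) {ρ : ℝ} (hρ : 0 < ρ) : volume (ball y ρ) = ENNReal.ofReal (ρ^3) * volume (ball (0:E3) 1) := by
  have := Measure.addHaar_ball_of_pos (volume : Measure E3) y hρ
  simpa [finrank_euclideanSpace] using this

/-- pair form of the local inequality -/
lemma LK_pair {Ω : Set E3} {G : E3 → FM} (hG : Measurable G) {e : E3 → ENNReal} {K : NNReal} (h : LK Ω G e K)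
    {y : E3} {ρ : ℝ} (hρ : 0 < ρ) (hy : closedBall y (4*ρ) ⊆ Ω) :
    ∫⁻ z in ball y ρ, ∫⁻ w in ball y ρ, ‖G z - G w‖ₑ^2 ≤
      4 * volume (ball y ρ) * (K * ∫⁻ z in ball y (2*ρ), e z) := by
  obtain ⟨M, hM⟩ := h y ρ hρ hy
  set v := volume (ball y ρ) with hv
  have hvt : v ≠ ⊤ := measure_ball_lt_top.ne
  set I := ∫⁻ y in ball y ρ, ‖G y - M‖ₑ^2 with hI
  have m1 : Measurable (fun z => ‖G z - M‖ₑ^2) := by fun_prop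
  calc ∫⁻ z in ball y ρ, ∫⁻ w in ball y ρ, ‖G z - G w‖ₑ^2
      ≤ ∫⁻ z in ball y ρ, ∫⁻ w in ball y ρ, (2 * ‖G z - M‖ₑ^2 + 2 * ‖G w - M‖ₑ^2) :=
        lintegral_mono (fun z => lintegral_mono (fun w => enorm_sq_tri _ _ _))
    _ = ∫⁻ z in ball y ρ, (2 * v * ‖G z - M‖ₑ^2 + 2 * I) := by
        congr 1; ext z
        rw [lintegral_add_right _ (m1.const_mul _), lintegral_const, lintegral_const_mul _ m1,
          Measure.restrict_apply_univ]
        ring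
    _ = 4 * v * I := by
        rw [lintegral_add_right _ measurable_const, lintegral_const, lintegral_const_mul _ m1,
          Measure.restrict_apply_univ]
        ring
    _ ≤ _ := by gcongr

lemma hh_meas {f : E3 → E3 → ENNReal} (hfm : Measurable (fun q : E3 × E3 => f q.1 q.2)) {r : E3 → ℝ}
    (hrm : Measurable r) (b : ℝ) :
    Measurable (fun q : E3 × E3 => (ball q.1 (4 * b * r q.1)).indicator (fun z => ∫⁻ w in ball q.1 (4 * b * r q.1), f z w) q.2) := by
  have s1 : MeasurableSet {p : (E3 × E3) × E3 | dist p.2 p.1.1 < 4 * b * r p.1.1} :=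
    measurableSet_lt (f := fun p : (E3 × E3) × E3 => dist p.2 p.1.1) (g := fun p => 4 * b * r p.1.1) (by fun_prop) (by fun_prop)
  have s2 : MeasurableSet {q : E3 × E3 | dist q.2 q.1 < 4 * b * r q.1} :=
    measurableSet_lt (f := fun p : E3 × E3 => dist p.2 p.1) (g := fun p => 4 * b * r p.1) (by fun_prop) (by fun_prop)
  have m0 : Measurable (fun p : (E3 × E3) × E3 => f p.1.2 p.2) :=
    hfm.comp (g := fun q : E3 × E3 => f q.1 q.2) (f := fun p : (E3 × E3) × E3 => (p.1.2, p.2)) (by fun_prop)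
  have m2 := (m0.indicator s1).lintegral_prod_right' (ν := (volume : Measure E3))
  have m3 := m2.indicator s2
  convert m3 using 2 with q
  by_cases hq : q.2 ∈ ball q.1 (4 * b * r q.1)
  · rw [indicator_of_mem hq, indicator_of_mem (show q ∈ {q : E3 × E3 | dist q.2 q.1 < 4 * b * r q.1} from hq), ← lintegral_indicator measurableSet_ball]
    rfl
  · rw [indicator_of_notMem hq, indicator_of_notMem (show q ∉ {q : E3 × E3 | dist q.2 q.1 < 4 * b * r q.1} from hq)]

set_option maxHeartbeats 2000000 in
lemma layer {Ω V : Set E3} {G : E3 → FM} (hG : Measurable G) {e : E3 → ENNReal} (he : Measurable e)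
    {K : NNReal} (h : LK Ω G e K) (hV : MeasurableSet V) (hΩ : MeasurableSet Ω)
    {r : E3 → ℝ} {L b c : ℝ} (hL : ∀ x y, |r x - r y| ≤ L * ‖x - y‖) (hL0 : 0 ≤ L)
    (hr : ∀ x ∈ V, 0 < r x) (hc : ∀ x ∈ V, closedBall x (c * r x) ⊆ Ω)
    (hb : 0 < b) (hbL : 16 * (b * L) ≤ 1) (hbc : 33 * b ≤ c)
    {Φ : E3 → E3} (hΦm : Measurable Φ) (hΦ : ∀ x ∈ V, ‖Φ x - x‖ ≤ b * r x)
    (hΦi : ∀ f : E3 → ENNReal, Measurable f → ∫⁻ x, f (Φ x) ≤ ∫⁻ x, f x) :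
    ∫⁻ x in V, ‖G x - G (Φ x)‖ₑ^2 ≤ (2 * 96^3 * K) * ∫⁻ x in Ω, e x := by
  have hrc : Continuous r := by
    refine (LipschitzWith.of_dist_le_mul (K := L.toNNReal) (fun x y => ?_)).continuous
    rw [Real.dist_eq, dist_eq_norm, Real.coe_toNNReal _ hL0]
    exact hL x y
  have hrm : Measurable r := hrc.measurable
  set ω := volume (ball (0:E3) 1) with hω
  have hωt : ω ≠ ⊤ := measure_ball_lt_top.ne
  have hω0 : ω ≠ 0 := (measure_ball_pos _ _ one_pos).ne'
  set f : E3 → E3 → ENNReal := fun z w => ‖G z - G w‖ₑ^2 with hf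
  have hfm : Measurable (fun q : E3 × E3 => f q.1 q.2) := by
    simp only [hf]; fun_prop
  set B : E3 → Set E3 := fun y => ball y (4 * b * r y) with hB
  have hBm : ∀ y, MeasurableSet (B y) := fun y => measurableSet_ball
  set VS : Set E3 := ⋃ x ∈ V, ball x (b * r x) with hVS
  have hVSm : MeasurableSet VS := (isOpen_biUnion (fun x _ => isOpen_ball)).measurableSet
  -- basic geometry
  have geo : ∀ x ∈ V, ∀ y, dist y x < b * r x → 0 < r y ∧ r y ≤ 2 * r x ∧ r x ≤ 2 * r y ∧
      x ∈ B y ∧ Φ x ∈ B y ∧ closedBall y (4 * (4 * b * r y)) ⊆ Ω := by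
    intro x hx y hy
    have hrx := hr x hx
    have h1 := hL y x
    rw [← dist_eq_norm] at h1
    have h2 : L * dist y x ≤ r x / 16 := by
      have : L * dist y x ≤ L * (b * r x) := by gcongr
      nlinarith
    have h3 := abs_le.1 (h1.trans h2)
    have a1 : 0 < r y := by linarith [h3.1]
    have a2 : r y ≤ 2 * r x := by linarith [h3.2]
    have a3 : r x ≤ 2 * r y := by linarith [h3.1]
    refine ⟨a1, a2, a3, ?_, ?_, ?_⟩
    · rw [hB, mem_ball, dist_comm]
      nlinarith
    · rw [hB, mem_ball]
      have := dist_triangle (Φ x) x y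
      have h4 := hΦ x hx
      rw [← dist_eq_norm] at h4
      rw [dist_comm x y] at this
      nlinarith
    · refine subset_trans (closedBall_subset_closedBall' ?_) (hc x hx)
      nlinarith
  -- the kernel
  set hh : E3 → E3 → ENNReal := fun y z => (B y).indicator (fun z => ∫⁻ w in B y, f z w) z with hhh
  set T : E3 → E3 → ENNReal := fun x y =>
    {q : E3 × E3 | q.1 ∈ V ∧ dist q.2 q.1 < b * r q.1}.indicator
      (fun q => ENNReal.ofReal ((r q.2^6)⁻¹) * (2 * hh q.2 q.1 + 2 * hh q.2 (Φ q.1))) (x,y) with hT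
  have hSm : MeasurableSet {q : E3 × E3 | q.1 ∈ V ∧ dist q.2 q.1 < b * r q.1} := by
    apply MeasurableSet.inter
    · exact measurable_fst hV
    · exact measurableSet_lt (f := fun q : E3 × E3 => dist q.2 q.1) (g := fun q => b * r q.1) (by fun_prop) (by fun_prop)
  have hhm : Measurable (fun q : E3 × E3 => hh q.1 q.2) := by
    exact hh_meas hfm hrm b
  have hTm : Measurable (fun q : E3 × E3 => T q.1 q.2) := by
    refine Measurable.indicator ?_ hSm
    have m1 : Measurable (fun q : E3 × E3 => hh q.2 q.1) := hhm.comp (g := fun q : E3 × E3 => hh q.1 q.2) (f := fun q : E3 × E3 => (q.2, q.1)) (by fun_prop)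
    have m2 : Measurable (fun q : E3 × E3 => hh q.2 (Φ q.1)) :=
      hhm.comp (g := fun q : E3 × E3 => hh q.1 q.2) (f := fun q : E3 × E3 => (q.2, Φ q.1)) (by fun_prop)
    fun_prop
  -- lower bound
  have lower : ∀ x ∈ V, ENNReal.ofReal (8 * b^6) * ω^2 * f x (Φ x) ≤ ∫⁻ y, T x y := by
    intro x hx
    have hrx := hr x hx
    calc ENNReal.ofReal (8 * b^6) * ω^2 * f x (Φ x) 
        = ∫⁻ y in ball x (b * r x), ENNReal.ofReal ((4*b)^3 * ((2 * r x)^3)⁻¹) * ω * f x (Φ x) := by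
          rw [setLIntegral_const, vol_ball x (by positivity)]
          have : ENNReal.ofReal (8 * b^6) = ENNReal.ofReal ((4*b)^3 * ((2 * r x)^3)⁻¹) * ENNReal.ofReal ((b * r x)^3) := by
            rw [← ENNReal.ofReal_mul (by positivity)]
            congr 1
            field_simp
            ring
          rw [this]; ring
      _ ≤ ∫⁻ y in ball x (b * r x), T x y := by
          refine setLIntegral_mono' measurableSet_ball (fun y hy => ?_)
          obtain ⟨g1, g2, g3, g4, g5, g6⟩ := geo x hx y hy
          have hm : (x,y) ∈ {q : E3 × E3 | q.1 ∈ V ∧ dist q.2 q.1 < b * r q.1} := ⟨hx, hy⟩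
          simp only [hT]
          rw [indicator_of_mem hm]
          simp only [hhh]
          rw [indicator_of_mem g4, indicator_of_mem g5]
          have k1 : f x (Φ x) * volume (B y) ≤ 2 * (∫⁻ w in B y, f x w) + 2 * ∫⁻ w in B y, f (Φ x) w := by
            have mx : ∀ x, Measurable (fun w => f x w) := fun x =>
              hfm.comp (g := fun q : E3 × E3 => f q.1 q.2) (f := fun w : E3 => (x, w)) (by fun_prop)
            rw [← setLIntegral_const, ← lintegral_const_mul _ (mx x), ← lintegral_const_mul _ (mx (Φ x)),
              ← lintegral_add_left ((mx x).const_mul _)]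
            exact lintegral_mono (fun w => enorm_sq_tri _ _ _)
          refine le_trans ?_ (mul_le_mul_right k1 _)
          rw [hB]
          simp only
          rw [vol_ball y (by positivity)]
          have k2 : ENNReal.ofReal ((4*b)^3 * ((2 * r x)^3)⁻¹) ≤ ENNReal.ofReal ((r y^6)⁻¹) * ENNReal.ofReal ((4 * b * r y)^3) := by
            rw [← ENNReal.ofReal_mul (by positivity)]
            apply ENNReal.ofReal_le_ofReal
            have : (r y^6)⁻¹ * (4 * b * r y)^3 = (4*b)^3 * (r y ^3)⁻¹ := by field_simp
            rw [this]
            gcongr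
          calc _ ≤ (ENNReal.ofReal ((r y^6)⁻¹) * ENNReal.ofReal ((4 * b * r y)^3)) * ω * f x (Φ x) := by gcongr
            _ = _ := by ring
      _ ≤ ∫⁻ y, T x y := setLIntegral_le_lintegral _ _
  -- upper bound
  have upper : ∀ y, ∫⁻ x, T x y ≤ VS.indicator (fun y => ENNReal.ofReal ((r y^3)⁻¹) *
      (ENNReal.ofReal (16 * (4*b)^3) * ω * (K * ∫⁻ z in ball y (8 * b * r y), e z))) y := by
    intro y
    by_cases hy : y ∈ VS
    · rw [indicator_of_mem hy]
      simp only [hVS, mem_iUnion] at hy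
      obtain ⟨x0, hx0, hy⟩ := hy
      obtain ⟨g1, g2, g3, g4, g5, g6⟩ := geo x0 hx0 y hy
      have mh : Measurable (hh y) := hhm.comp (g := fun q : E3 × E3 => hh q.1 q.2) (f := fun w : E3 => (y, w)) (by fun_prop)
      calc ∫⁻ x, T x y ≤ ∫⁻ x, ENNReal.ofReal ((r y^6)⁻¹) * (2 * hh y x + 2 * hh y (Φ x)) := by
            refine lintegral_mono (fun x => ?_)
            simp only [hT]
            exact indicator_le_self _ _ _
        _ = ENNReal.ofReal ((r y^6)⁻¹) * (2 * (∫⁻ x, hh y x) + 2 * ∫⁻ x, hh y (Φ x)) := by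
            rw [lintegral_const_mul _ (by fun_prop), lintegral_add_left (by fun_prop),
              lintegral_const_mul _ (by fun_prop), lintegral_const_mul _ (by fun_prop)]
        _ ≤ ENNReal.ofReal ((r y^6)⁻¹) * (2 * (∫⁻ x, hh y x) + 2 * ∫⁻ x, hh y x) := by
            exact mul_le_mul_right (add_le_add_right (mul_le_mul_right (hΦi _ mh) _) _) _
        _ = ENNReal.ofReal ((r y^6)⁻¹) * (4 * ∫⁻ x, hh y x) := by ring
        _ ≤ ENNReal.ofReal ((r y^6)⁻¹) * (4 * (4 * volume (B y) * (K * ∫⁻ z in ball y (2 * (4 * b * r y)), e z))) := by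
            refine mul_le_mul_right (mul_le_mul_right ?_ _) _
            simp only [hhh]
            rw [lintegral_indicator (hBm y)]
            exact LK_pair hG h (by positivity) g6
        _ = _ := by
            rw [hB]
            simp only
            rw [vol_ball y (by positivity)]
            have k : ENNReal.ofReal ((r y^6)⁻¹) * ENNReal.ofReal ((4 * b * r y)^3) * 16 = ENNReal.ofReal ((r y^3)⁻¹) * ENNReal.ofReal (16 * (4*b)^3) := by
              rw [show (16:ENNReal) = ENNReal.ofReal 16 by norm_num, ← ENNReal.ofReal_mul (by positivity), ← ENNReal.ofReal_mul (by positivity), ← ENNReal.ofReal_mul (by positivity)]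
              congr 1
              field_simp
            rw [show 2 * (4 * b * r y) = 8 * b * r y by ring]
            calc _ = (ENNReal.ofReal ((r y^6)⁻¹) * ENNReal.ofReal ((4 * b * r y)^3) * 16) * (ω * (K * ∫⁻ z in ball y (8 * b * r y), e z)) := by ring
              _ = _ := by rw [k]; ring
    · rw [indicator_of_notMem hy]
      have : ∀ x, T x y = 0 := by
        intro x
        simp only [hT]
        rw [indicator_of_notMem]
        rintro ⟨h1, h2⟩
        exact hy (mem_biUnion h1 h2)
      simp [this]
  -- final swap
  set N : E3 → E3 → ENNReal := fun y z => {q : E3 × E3 | q.1 ∈ VS ∧ dist q.2 q.1 < 8 * b * r q.1}.indicator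
     (fun q => ENNReal.ofReal ((r q.1^3)⁻¹) * e q.2) (y,z) with hN
  have hNm : Measurable (fun q : E3 × E3 => N q.1 q.2) := by
    refine Measurable.indicator (by fun_prop) ?_
    apply MeasurableSet.inter
    · exact measurable_fst hVSm
    · exact measurableSet_lt (f := fun q : E3 × E3 => dist q.2 q.1) (g := fun q => 8 * b * r q.1) (by fun_prop) (by fun_prop)
  have swapped : ∫⁻ y, VS.indicator (fun y => ENNReal.ofReal ((r y^3)⁻¹) * ∫⁻ z in ball y (8 * b * r y), e z) y
      ≤ ENNReal.ofReal ((24*b)^3) * ω * ∫⁻ x in Ω, e x := by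
    have e1 : ∀ y, VS.indicator (fun y => ENNReal.ofReal ((r y^3)⁻¹) * ∫⁻ z in ball y (8 * b * r y), e z) y = ∫⁻ z, N y z := by
      intro y
      by_cases hy : y ∈ VS
      · rw [indicator_of_mem hy, ← lintegral_const_mul _ he, ← lintegral_indicator measurableSet_ball]
        congr 1; ext z
        simp only [hN, indicator]
        congr 1
        simp [hy]
      · rw [indicator_of_notMem hy]
        simp [hN, indicator, hy]
    simp only [e1]
    rw [lintegral_lintegral_swap hNm.aemeasurable, ← lintegral_indicator hΩ, ← lintegral_const_mul _ (he.indicator hΩ)]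
    refine lintegral_mono (fun z => ?_)
    calc ∫⁻ y, N y z ≤ ∫⁻ y in ball z (16 * b * r z), ENNReal.ofReal ((3/2)^3 * (r z^3)⁻¹) * Ω.indicator e z := by
          rw [← lintegral_indicator measurableSet_ball]
          refine lintegral_mono (fun y => ?_)
          simp only [hN]
          by_cases hq : (y,z) ∈ {q : E3 × E3 | q.1 ∈ VS ∧ dist q.2 q.1 < 8 * b * r q.1}
          · obtain ⟨hy, hyz⟩ := id hq
            simp only at hy hyz
            rw [hVS] at hy
            simp only [mem_iUnion] at hy
            obtain ⟨x0, hx0, hy⟩ := hy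
            obtain ⟨g1, g2, g3, g4, g5, g6⟩ := geo x0 hx0 y hy
            have h1 := hL z y
            rw [← dist_eq_norm] at h1
            have h2 : L * dist z y ≤ r y / 2 := by
              have : L * dist z y ≤ L * (8 * b * r y) := by gcongr
              nlinarith
            have h3 := abs_le.1 (h1.trans h2)
            have hrz : 0 < r z := by linarith
            rw [indicator_of_mem hq, indicator_of_mem (show y ∈ ball z (16 * b * r z) by
              rw [mem_ball, dist_comm]; nlinarith [h3.1]),
              indicator_of_mem (g6 (show z ∈ _ by rw [mem_closedBall]; nlinarith))]
            simp only
            gcongr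
            have : (r y ^3)⁻¹ ≤ ((2/3 * r z)^3)⁻¹ := by gcongr; linarith
            refine this.trans (le_of_eq ?_)
            field_simp
          · rw [indicator_of_notMem hq]; exact zero_le
      _ ≤ _ := by
          rw [setLIntegral_const]
          by_cases hrz : 0 < r z
          · rw [vol_ball z (by positivity)]
            apply le_of_eq
            have : ENNReal.ofReal ((24*b)^3) = ENNReal.ofReal ((3/2)^3 * (r z^3)⁻¹) * ENNReal.ofReal ((16 * b * r z)^3) := by
              rw [← ENNReal.ofReal_mul (by positivity)]
              congr 1
              field_simp
              norm_num
            rw [this]; ring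
          · have : ball z (16 * b * r z) = ∅ := ball_eq_empty.2 (by nlinarith)
            simp [this]
  set E := ∫⁻ x in Ω, e x with hE
  have main : ENNReal.ofReal (8 * b^6) * ω^2 * ∫⁻ x in V, f x (Φ x) ≤
      ENNReal.ofReal (8 * b^6) * ω^2 * ((2 * 96^3 * K) * E) := by
    have mf : Measurable (fun x => f x (Φ x)) := hfm.comp (g := fun q : E3 × E3 => f q.1 q.2) (f := fun x : E3 => (x, Φ x)) (by fun_prop)
    have me : Measurable (fun y => ∫⁻ z, N y z) := hNm.lintegral_prod_right'
    calc ENNReal.ofReal (8 * b^6) * ω^2 * ∫⁻ x in V, f x (Φ x) 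
        = ∫⁻ x in V, ENNReal.ofReal (8 * b^6) * ω^2 * f x (Φ x) := by
          rw [lintegral_const_mul _ mf]
      _ ≤ ∫⁻ x in V, ∫⁻ y, T x y := setLIntegral_mono' hV lower
      _ ≤ ∫⁻ x, ∫⁻ y, T x y := setLIntegral_le_lintegral _ _
      _ = ∫⁻ y, ∫⁻ x, T x y := lintegral_lintegral_swap hTm.aemeasurable
      _ ≤ ∫⁻ y, (ENNReal.ofReal (16 * (4*b)^3) * ω * K) * VS.indicator (fun y => ENNReal.ofReal ((r y^3)⁻¹) * ∫⁻ z in ball y (8 * b * r y), e z) y := by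
          refine lintegral_mono (fun y => (upper y).trans (le_of_eq ?_))
          by_cases hy : y ∈ VS
          · rw [indicator_of_mem hy, indicator_of_mem hy]; ring
          · rw [indicator_of_notMem hy, indicator_of_notMem hy]; simp
      _ = (ENNReal.ofReal (16 * (4*b)^3) * ω * K) * ∫⁻ y, VS.indicator (fun y => ENNReal.ofReal ((r y^3)⁻¹) * ∫⁻ z in ball y (8 * b * r y), e z) y := 
          lintegral_const_mul' _ _ (by finiteness)
      _ ≤ (ENNReal.ofReal (16 * (4*b)^3) * ω * K) * (ENNReal.ofReal ((24*b)^3) * ω * E) := by gcongr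
      _ = _ := by
          have : ENNReal.ofReal (8 * b^6) * (2 * 96^3) = ENNReal.ofReal (16 * (4*b)^3) * ENNReal.ofReal ((24*b)^3) := by
            rw [show (2 * 96^3 :ENNReal) = ENNReal.ofReal (2*96^3) by norm_num, ← ENNReal.ofReal_mul (by positivity), ← ENNReal.ofReal_mul (by positivity)]
            congr 1
            ring
          calc _ = (ENNReal.ofReal (16 * (4*b)^3) * ENNReal.ofReal ((24*b)^3)) * ω^2 * K * E := by ring
            _ = _ := by rw [← this]; ring
  have hne : ENNReal.ofReal (8 * b^6) * ω^2 ≠ 0 := by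
    refine mul_ne_zero ?_ (pow_ne_zero _ hω0)
    rw [Ne, ENNReal.ofReal_eq_zero, not_le]; positivity
  exact (ENNReal.mul_le_mul_iff_right hne (by finiteness)).1 main

def mk3 (y : Fin 2 → ℝ) (s : ℝ) : E3 := WithLp.toLp 2 (Fin.insertNth 2 s y)
lemma mk3_0 (y : Fin 2 → ℝ) (s : ℝ) : mk3 y s 0 = y 0 := rfl
lemma mk3_1 (y : Fin 2 → ℝ) (s : ℝ) : mk3 y s 1 = y 1 := rfl
lemma mk3_2 (y : Fin 2 → ℝ) (s : ℝ) : mk3 y s 2 = s := rfl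

lemma lintegral_mk3 (f : E3 → ENNReal) (hf : Measurable f) :
    ∫⁻ x, f x = ∫⁻ y, ∫⁻ s, f (mk3 y s) := by
  have h1 := (PiLp.volume_preserving_toLp (Fin 3)).lintegral_comp hf
  have h2 := (volume_preserving_piFinSuccAbove (fun _ : Fin 3 => ℝ) 2).symm
  have mm : Measurable (fun a : Fin 3 → ℝ => f (WithLp.toLp 2 a)) := 
    hf.comp (WithLp.measurable_toLp 2 (Fin 3 → ℝ))
  have h3 := h2.lintegral_comp mm
  have m4 := mm.comp (MeasurableEquiv.piFinSuccAbove (fun _ : Fin 3 => ℝ) 2).symm.measurable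
  rw [← h1, ← h3, Measure.volume_eq_prod]
  exact lintegral_prod_symm' _ m4

lemma lintegral_aff1 (g : ℝ → ENNReal) (hg : Measurable g) {l : ℝ} (hl : 0 < l) (c : ℝ) :
    ∫⁻ s, g (l * s + c) = ENNReal.ofReal l⁻¹ * ∫⁻ s, g s := by
  have h1 : ∫⁻ s, g (l * s + c) = ∫⁻ s, g (s + c) ∂(Measure.map (l * ·) volume) := by
    rw [lintegral_map (by fun_prop) (by fun_prop)]
  rw [h1, Real.map_volume_mul_left hl.ne', lintegral_smul_measure, lintegral_add_right_eq_self,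
    abs_of_pos (by positivity), smul_eq_mul]

def rr (ψ : E2 → ℝ) (x : E3) : ℝ := ψ (proj12 x) - x 2
def PH (ψ : E2 → ℝ) (κ : ℝ) (x : E3) : E3 := x - (κ * rr ψ x) • ee 2

lemma proj12_mk3 (y : Fin 2 → ℝ) (s : ℝ) : proj12 (mk3 y s) = WithLp.toLp 2 y := by
  ext k
  fin_cases k <;> simp [proj12, mk3_0, mk3_1]

lemma proj12_0 (x : E3) : proj12 x 0 = x 0 := by simp [proj12]
lemma proj12_1 (x : E3) : proj12 x 1 = x 1 := by simp [proj12]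

lemma PH_0 (ψ : E2 → ℝ) (κ : ℝ) (x : E3) : PH ψ κ x 0 = x 0 := by simp [PH, ee]
lemma PH_1 (ψ : E2 → ℝ) (κ : ℝ) (x : E3) : PH ψ κ x 1 = x 1 := by simp [PH, ee]
lemma PH_2 (ψ : E2 → ℝ) (κ : ℝ) (x : E3) : PH ψ κ x 2 = x 2 - κ * rr ψ x := by simp [PH, ee]
lemma proj12_PH (ψ : E2 → ℝ) (κ : ℝ) (x : E3) : proj12 (PH ψ κ x) = proj12 x := by
  simp only [proj12, PH_0, PH_1]
lemma rr_PH (ψ : E2 → ℝ) (κ : ℝ) (x : E3) : rr ψ (PH ψ κ x) = (1+κ) * rr ψ x := by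
  rw [rr, proj12_PH, PH_2]; unfold rr; ring

lemma proj12_cont : Continuous proj12 := by
  unfold proj12
  have := fun i => (coord_cd i).continuous
  fun_prop

lemma PH_mk3 (ψ : E2 → ℝ) (κ : ℝ) (y : Fin 2 → ℝ) (s : ℝ) :
    PH ψ κ (mk3 y s) = mk3 y ((1+κ) * s + (- κ * ψ (WithLp.toLp 2 y))) := by
  ext k
  fin_cases k
  · exact PH_0 _ _ _
  · exact PH_1 _ _ _
  · refine (PH_2 _ _ _).trans ?_
    rw [rr, proj12_mk3, mk3_2]
    refine Eq.trans ?_ (mk3_2 y _).symm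
    ring

lemma rr_cont {ψ : E2 → ℝ} (hψ : Continuous ψ) : Continuous (rr ψ) := by
  unfold rr
  exact (hψ.comp proj12_cont).sub (coord_cd 2).continuous

lemma PH_cont {ψ : E2 → ℝ} (hψ : Continuous ψ) (κ : ℝ) : Continuous (PH ψ κ) := by
  unfold PH
  have := rr_cont hψ
  fun_prop

lemma mk3_meas (y : Fin 2 → ℝ) : Measurable (mk3 y) := by
  unfold mk3
  refine (WithLp.measurable_toLp 2 (Fin 3 → ℝ)).comp (measurable_pi_lambda _ (fun k => ?_))
  fin_cases k
  · exact measurable_const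
  · exact measurable_const
  · exact measurable_id

lemma PH_lintegral {ψ : E2 → ℝ} (hψ : Continuous ψ) {κ : ℝ} (hκ : 0 < κ) (f : E3 → ENNReal) (hf : Measurable f) :
    ∫⁻ x, f (PH ψ κ x) = ENNReal.ofReal (1+κ)⁻¹ * ∫⁻ x, f x := by
  rw [lintegral_mk3 (fun x => f (PH ψ κ x)) (hf.comp (PH_cont hψ κ).measurable), lintegral_mk3 f hf]
  simp only [PH_mk3]
  have : ∀ y, ∫⁻ s, f (mk3 y ((1+κ) * s + (- κ * ψ (WithLp.toLp 2 y)))) = ENNReal.ofReal (1+κ)⁻¹ * ∫⁻ s, f (mk3 y s) :=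
    fun y => lintegral_aff1 (fun s => f (mk3 y s)) (hf.comp (mk3_meas y)) (by linarith) _
  simp only [this]
  exact lintegral_const_mul' _ _ ENNReal.ofReal_ne_top

lemma norm3 (x : E3) : ‖x‖^2 = (x 0)^2 + (x 1)^2 + (x 2)^2 := by
  rw [EuclideanSpace.norm_sq_eq, Fin.sum_univ_three]; simp
lemma norm2 (x : E2) : ‖x‖^2 = (x 0)^2 + (x 1)^2 := by
  rw [EuclideanSpace.norm_sq_eq, Fin.sum_univ_two]; simp
lemma norm3_split (x : E3) : ‖x‖^2 = ‖proj12 x‖^2 + (x 2)^2 := by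
  rw [norm3, norm2, proj12_0, proj12_1]
lemma norm_proj12_le (x : E3) : ‖proj12 x‖ ≤ ‖x‖ := by
  have := norm3_split x
  exact le_of_sq_le_sq (by nlinarith [sq_nonneg (x 2)]) (norm_nonneg _)
lemma abs2_le (x : E3) : |x 2| ≤ ‖x‖ := by
  have := norm3_split x
  exact abs_le_of_sq_le_sq (by nlinarith [sq_nonneg ‖proj12 x‖]) (norm_nonneg _)
lemma norm_le_split (x : E3) : ‖x‖ ≤ ‖proj12 x‖ + |x 2| := by
  have := norm3_split x
  have h := sq_abs (x 2)
  exact le_of_sq_le_sq (by nlinarith [norm_nonneg (proj12 x), abs_nonneg (x 2), mul_nonneg (norm_nonneg (proj12 x)) (abs_nonneg (x 2))]) (by positivity)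
lemma proj12_sub (x y : E3) : proj12 (x - y) = proj12 x - proj12 y := by
  ext k; fin_cases k <;> simp [proj12]

lemma rr_lip {ψ : E2 → ℝ} {E₀ : ℝ} (hE : 0 ≤ E₀) (hψ : ∀ x y, |ψ x - ψ y| ≤ E₀ * ‖x - y‖) (x y : E3) :
    |rr ψ x - rr ψ y| ≤ (E₀ + 1) * ‖x - y‖ := by
  have h1 := hψ (proj12 x) (proj12 y)
  rw [← proj12_sub] at h1
  have h2 := norm_proj12_le (x - y)
  have h3 := abs2_le (x - y)
  have e : rr ψ x - rr ψ y = (ψ (proj12 x) - ψ (proj12 y)) - (x - y) 2 := by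
    unfold rr; simp; ring
  rw [e]
  refine (abs_sub _ _).trans ?_
  nlinarith

lemma alg_absorb {a a' e : ENNReal} (ha : a ≠ ⊤) {θ C : ℝ} (hθ0 : 0 ≤ θ) (hθ : θ < 1) (hC : 0 ≤ C)
    (h : a ≤ ENNReal.ofReal θ * (a + a') + ENNReal.ofReal C * e) :
    a ≤ ENNReal.ofReal ((1-θ)⁻¹ * (1 + C)) * (a' + e) := by
  have hp : 0 < (1-θ)⁻¹ * (1 + C) := mul_pos (inv_pos.2 (by linarith)) (by linarith)
  by_cases h1 : a' = ⊤
  · rw [h1, top_add, ENNReal.mul_top]; · exact le_top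
    rw [Ne, ENNReal.ofReal_eq_zero, not_le]; exact hp
  by_cases h2 : e = ⊤
  · rw [h2, add_top, ENNReal.mul_top]; · exact le_top
    rw [Ne, ENNReal.ofReal_eq_zero, not_le]; exact hp
  lift a to NNReal using ha
  lift a' to NNReal using h1
  lift e to NNReal using h2
  have hx := a.coe_nonneg
  have hx' := a'.coe_nonneg
  have he := e.coe_nonneg
  rw [← ENNReal.ofReal_coe_nnreal, ← ENNReal.ofReal_coe_nnreal (p := a'), ← ENNReal.ofReal_coe_nnreal (p := e)] at h ⊢
  rw [← ENNReal.ofReal_add hx hx', ← ENNReal.ofReal_mul hθ0, ← ENNReal.ofReal_mul hC, ← ENNReal.ofReal_add (by positivity) (by positivity),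
    ENNReal.ofReal_le_ofReal_iff (by positivity)] at h
  rw [← ENNReal.ofReal_add hx' he, ← ENNReal.ofReal_mul hp.le]
  apply ENNReal.ofReal_le_ofReal
  have h3 : (1-θ) * (a:ℝ) ≤ (1 + C) * (a' + e) := by nlinarith [mul_nonneg hC hx']
  rw [mul_assoc, inv_mul_eq_div, le_div_iff₀ (by linarith)]
  linarith

def CA (κ : ℝ) (K : NNReal) : ℝ := (1 - (1+κ/2) * (1+κ)⁻¹)⁻¹ * (1 + (1+(κ/2)⁻¹) * (2*96^3*K))

lemma absorb {Ω V V' : Set E3} {G : E3 → FM} (hG : Measurable G) {e : E3 → ENNReal} (he : Measurable e)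
    {K : NNReal} (h : LK Ω G e K) (hV : MeasurableSet V) (hV' : MeasurableSet V') (hΩ : MeasurableSet Ω)
    {ψ : E2 → ℝ} {E₀ κ c : ℝ} (hE : 0 ≤ E₀) (hψ : ∀ x y, |ψ x - ψ y| ≤ E₀ * ‖x - y‖) (hψc : Continuous ψ)
    (hr : ∀ x ∈ V, 0 < rr ψ x) (hc : ∀ x ∈ V, closedBall x (c * rr ψ x) ⊆ Ω)
    (hb : 0 < κ) (hbL : 16 * (κ * (E₀+1)) ≤ 1) (hbc : 33 * κ ≤ c)
    (hmap : ∀ x ∈ V, PH ψ κ x ∈ V ∪ V') (M : FM) (hfin : ∫⁻ x in V, ‖G x - M‖ₑ^2 ≠ ⊤) :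
    ∫⁻ x in V, ‖G x - M‖ₑ^2 ≤ ENNReal.ofReal (CA κ K) * ((∫⁻ x in V', ‖G x - M‖ₑ^2) + ∫⁻ x in Ω, e x) := by
  have hPm : Measurable (PH ψ κ) := (PH_cont hψc κ).measurable
  have hlay := layer hG he h hV hΩ (rr_lip hE hψ) (by linarith) hr hc hb hbL hbc hPm
    (fun x hx => by
      rw [PH, sub_sub_cancel_left, norm_neg, norm_smul, Real.norm_eq_abs, abs_of_pos (mul_pos hb (hr x hx))]
      simp [ee])
    (fun f hf => by
      rw [PH_lintegral hψc hb f hf]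
      refine mul_le_of_le_one_left' ?_
      rw [ENNReal.ofReal_le_one]
      exact inv_le_one_of_one_le₀ (by linarith))
  set E := ∫⁻ x in Ω, e x
  have m1 : Measurable (fun z => ‖G z - M‖ₑ^2) := by fun_prop
  refine alg_absorb hfin (by positivity) ?_ (by positivity) ?_
  · rw [← div_eq_mul_inv, div_lt_one (by linarith)]; linarith
  calc ∫⁻ x in V, ‖G x - M‖ₑ^2 
      ≤ ∫⁻ x in V, (ENNReal.ofReal (1+κ/2) * ‖G (PH ψ κ x) - M‖ₑ^2 + ENNReal.ofReal (1+(κ/2)⁻¹) * ‖G x - G (PH ψ κ x)‖ₑ^2) :=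
        lintegral_mono (fun x => enorm_sq_eps _ _ _ (by positivity))
    _ = ENNReal.ofReal (1+κ/2) * (∫⁻ x in V, ‖G (PH ψ κ x) - M‖ₑ^2) + ENNReal.ofReal (1+(κ/2)⁻¹) * ∫⁻ x in V, ‖G x - G (PH ψ κ x)‖ₑ^2 := by
        rw [lintegral_add_left (by fun_prop), lintegral_const_mul _ (by fun_prop), lintegral_const_mul _ (by fun_prop)]
    _ ≤ ENNReal.ofReal (1+κ/2) * (ENNReal.ofReal (1+κ)⁻¹ * ∫⁻ x in V ∪ V', ‖G x - M‖ₑ^2) + ENNReal.ofReal (1+(κ/2)⁻¹) * ((2 * 96^3 * K) * E) := by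
        refine add_le_add (mul_le_mul_right ?_ _) (mul_le_mul_right hlay _)
        rw [← lintegral_indicator (hV.union hV'), ← PH_lintegral hψc hb _ (m1.indicator (hV.union hV')), ← lintegral_indicator hV]
        refine lintegral_mono (fun x => ?_)
        by_cases hx : x ∈ V
        · rw [indicator_of_mem hx, indicator_of_mem (hmap x hx)]
        · rw [indicator_of_notMem hx]; exact zero_le
    _ ≤ ENNReal.ofReal (1+κ/2) * (ENNReal.ofReal (1+κ)⁻¹ * ((∫⁻ x in V, ‖G x - M‖ₑ^2) + ∫⁻ x in V', ‖G x - M‖ₑ^2)) + ENNReal.ofReal (1+(κ/2)⁻¹) * ((2 * 96^3 * K) * E) := by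
        gcongr
        exact lintegral_union_le _ _ _
    _ = _ := by
        rw [ENNReal.ofReal_mul (by positivity), ENNReal.ofReal_mul (p := 1+(κ/2)⁻¹) (by positivity), ENNReal.ofReal_mul (p := 2*96^3) (by positivity),
          ENNReal.ofReal_coe_nnreal, show ENNReal.ofReal (2*96^3) = 2*96^3 by norm_num]
        ring

lemma CA_nonneg {κ : ℝ} (hκ : 0 < κ) (K : NNReal) : 0 ≤ CA κ K := by
  unfold CA
  have : 0 < 1 - (1+κ/2) * (1+κ)⁻¹ := by
    rw [← div_eq_mul_inv, sub_pos, div_lt_one (by linarith)]; linarith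
  positivity

/-- the far lemma -/
lemma far {Ω : Set E3} {R : ℝ} (hR : 0 < R) (hΩ : MeasurableSet Ω) (hΩs : Ω ⊆ lowerHalf)
    (hΩR : ∀ x : E3, x 2 < 0 → 3/4 * R < ‖x‖ → x ∈ Ω)
    {G : E3 → FM} (hG : Measurable G) {e : E3 → ENNReal} (he : Measurable e)
    {K : NNReal} (h : LK Ω G e K) (hfin : ∫⁻ x in Ω, ‖G x‖ₑ^2 ≠ ⊤) :
    ∫⁻ x in Ω \ closedBall 0 R, ‖G x‖ₑ^2 ≤ ENNReal.ofReal (CA (1/132) K) * ∫⁻ x in Ω, e x := by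
  have hm : MeasurableSet (Ω \ closedBall (0:E3) R) := hΩ.diff measurableSet_closedBall
  have hrr : ∀ x : E3, rr (fun _ => 0) x = - x 2 := fun x => by simp [rr]
  have key := absorb (V := Ω \ closedBall (0:E3) R) (V' := ∅) hG he h hm MeasurableSet.empty hΩ (ψ := fun _ => 0) (E₀ := 0) (κ := 1/132) (c := 1/4)
    le_rfl (by simp) continuous_const ?_ ?_ (by norm_num) (by norm_num) (by norm_num) ?_ 0 ?_
  · simpa using key
  · intro x hx
    rw [hrr]
    have : x 2 < 0 := hΩs hx.1
    linarith
  · intro x hx z hz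
    have h1 : x 2 < 0 := hΩs hx.1
    have h2 : R < ‖x‖ := by simpa using hx.2
    rw [hrr, mem_closedBall, dist_eq_norm] at hz
    have h3 := abs2_le x
    have h4 := abs2_le (z - x)
    have h5 : (z - x) 2 = z 2 - x 2 := by simp
    rw [h5] at h4
    have h6 := abs_le.1 h4
    rw [abs_of_neg h1] at h3
    have h7 := norm_sub_norm_le x z
    rw [norm_sub_rev] at h7
    exact hΩR z (by linarith) (by linarith)
  · intro x hx
    have h1 : x 2 < 0 := hΩs hx.1
    have h2 : R < ‖x‖ := by simpa using hx.2
    left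
    have h3 : (PH (fun _ => 0) (1/132) x) 2 = (133/132) * x 2 := by
      rw [PH_2, hrr]; ring
    have h4 : ‖x‖ ≤ ‖PH (fun _ => 0) (1/132) x‖ := by
      refine le_of_sq_le_sq ?_ (norm_nonneg _)
      rw [norm3, norm3, PH_0, PH_1, h3]
      nlinarith [sq_nonneg (x 2)]
    refine ⟨hΩR _ (by rw [h3]; linarith) (by linarith), ?_⟩
    simp; linarith
  · simp only [sub_zero]
    exact ne_top_of_le_ne_top hfin (lintegral_mono_set diff_subset)

lemma fin_sub {V : Set E3} {G : E3 → FM} (hG : Measurable G) (M : FM) (hV : volume V ≠ ⊤)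
    (hf : ∫⁻ x in V, ‖G x‖ₑ^2 ≠ ⊤) : ∫⁻ x in V, ‖G x - M‖ₑ^2 ≠ ⊤ := by
  have : ∫⁻ x in V, ‖G x - M‖ₑ^2 ≤ ∫⁻ x in V, (2 * ‖G x‖ₑ^2 + 2 * ‖M‖ₑ^2) :=
    lintegral_mono (fun x => by simpa using enorm_sq_tri (G x) 0 M)
  refine ne_top_of_le_ne_top ?_ this
  rw [lintegral_add_left (by fun_prop), lintegral_const_mul _ (by fun_prop), lintegral_const, Measure.restrict_apply_univ]
  refine ENNReal.add_ne_top.2 ⟨ENNReal.mul_ne_top (by simp) hf, ENNReal.mul_ne_top (ENNReal.mul_ne_top (by simp) ?_) hV⟩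
  exact ENNReal.pow_ne_top (by simp)

lemma chart_std {Ω : Set E3} (hΩ : MeasurableSet Ω) {G : E3 → FM} (hG : Measurable G) {e : E3 → ENNReal} (he : Measurable e)
    {K : NNReal} (h : LK Ω G e K) (hfin : ∫⁻ x in Ω, ‖G x‖ₑ^2 ≠ ⊤)
    {ψ : E2 → ℝ} {E₀ r : ℝ} (hE : 0 ≤ E₀) (hψ : ∀ x y, |ψ x - ψ y| ≤ E₀ * ‖x - y‖) (hψ0 : ψ 0 = 0) (hψc : Continuous ψ)
    (hr : 0 < r) (hch : ∀ x, ‖x‖ < r → (x ∈ Ω ↔ 0 < rr ψ x)) :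
    ∃ M, ∫⁻ x in Ω ∩ ball 0 (r / (264 * (E₀+1)^2)), ‖G x - M‖ₑ^2 ≤
      ENNReal.ofReal (CA (1/(66*(E₀+1))) K * (K+1)) * ∫⁻ x in Ω, e x := by
  obtain ⟨L, hL⟩ : ∃ L, L = E₀ + 1 := ⟨_, rfl⟩
  obtain ⟨κ, hκ⟩ : ∃ κ, κ = 1/(66*L) := ⟨_, rfl⟩
  obtain ⟨H, hH⟩ : ∃ H, H = r/4 := ⟨_, rfl⟩
  obtain ⟨ρ, hρ⟩ : ∃ ρ, ρ = r / (264 * L^2) := ⟨_, rfl⟩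
  rw [← hL, ← hκ, ← hρ]
  have L1 : 1 ≤ L := by linarith
  have H0 : 0 < H := by linarith
  have κ0 : 0 < κ := by rw [hκ]; positivity
  have κL : κ * L = 1/66 := by rw [hκ]; field_simp
  have κ1 : κ ≤ 1/66 := by nlinarith
  have ρL : L * ρ = κ * H := by rw [hρ, hκ, hH]; field_simp; norm_num
  have ρ0 : 0 < ρ := by rw [hρ]; positivity
  have κH0 : 0 < κ * H := by positivity
  have κH : κ * H ≤ H/66 := by nlinarith
  have ρκ : ρ ≤ κ * H := by nlinarith
  have hEρ : E₀ * ρ + ρ = κ * H := by rw [← ρL, hL]; ring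
  have hrrl := rr_lip hE hψ
  rw [← hL] at hrrl
  have hψb : ∀ x : E3, ‖proj12 x‖ < ρ → |ψ (proj12 x)| ≤ E₀ * ρ := fun x hx => by
    have := hψ (proj12 x) 0
    rw [hψ0, sub_zero, sub_zero] at this
    exact this.trans (mul_le_mul_of_nonneg_left hx.le hE)
  set V : Set E3 := {x | ‖proj12 x‖ < ρ ∧ 0 < rr ψ x ∧ rr ψ x < H} with hVd
  set V' : Set E3 := {x | ‖proj12 x‖ < ρ ∧ H ≤ rr ψ x ∧ rr ψ x < (1+κ)*H} with hVd'
  have c1 := rr_cont hψc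
  have c2 := proj12_cont
  have hV : MeasurableSet V := by
    refine ((isOpen_lt c2.norm continuous_const).inter ((isOpen_lt continuous_const c1).inter (isOpen_lt c1 continuous_const))).measurableSet
  have hV' : MeasurableSet V' := by
    refine (isOpen_lt c2.norm continuous_const).measurableSet.inter ((isClosed_le continuous_const c1).measurableSet.inter (isOpen_lt c1 continuous_const).measurableSet)
  have hVn : ∀ x ∈ V, ‖x‖ ≤ (1+κ)*H := by
    rintro x ⟨h1, h2, h3⟩
    have h4 := abs_le.1 (hψb x h1)
    have h5 := norm_le_split x
    have h6 : |x 2| ≤ E₀ * ρ + H := by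
      rw [abs_le]; unfold rr at h2 h3; constructor <;> linarith
    linarith
  have hVΩ : V ⊆ Ω := fun x hx => (hch x (by have := hVn x hx; nlinarith)).2 hx.2.1
  obtain ⟨p, hp⟩ : ∃ p : E3, p = -(H • ee 2) := ⟨_, rfl⟩
  have p0 : p 0 = 0 := by rw [hp]; simp [ee]
  have p1 : p 1 = 0 := by rw [hp]; simp [ee]
  have p2 : p 2 = -H := by rw [hp]; simp [ee]
  have pp : proj12 p = 0 := by unfold proj12; rw [p0, p1]; simp
  have pr : rr ψ p = H := by rw [rr, pp, hψ0, p2]; ring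
  have pn : ‖p‖ = H := by rw [hp, norm_neg, norm_smul]; simp [ee, abs_of_pos H0]
  have hVb : V' ⊆ ball p (3*(κ*H)) := by
    rintro x ⟨h1, h2, h3⟩
    have h4 := abs_le.1 (hψb x h1)
    have h5 := norm_le_split (x - p)
    rw [proj12_sub, pp, sub_zero] at h5
    have h6 : |(x - p) 2| ≤ E₀ * ρ + κ * H := by
      have : (x - p) 2 = x 2 + H := by simp [p2]
      rw [this, abs_le]; unfold rr at h2 h3; constructor <;> linarith
    rw [mem_ball, dist_eq_norm]
    linarith
  obtain ⟨M, hM⟩ := h p (3*(κ*H)) (by positivity) (by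
    intro z hz
    rw [mem_closedBall, dist_eq_norm] at hz
    have h1 := abs_le.1 (hrrl z p)
    rw [pr] at h1
    have h2 : ‖z‖ ≤ ‖z - p‖ + ‖p‖ := by simpa using norm_add_le (z - p) p
    refine (hch z (by linarith)).2 ?_
    have h3 : L * ‖z - p‖ ≤ L * (4 * (3*(κ*H))) := mul_le_mul_of_nonneg_left hz (by linarith)
    have h4 : L * (4 * (3*(κ*H))) = 12 * (κ*L) * H := by ring
    rw [h4, κL] at h3
    linarith)
  refine ⟨M, ?_⟩
  have key := absorb hG he h hV hV' hΩ hE hψ hψc (c := 1/(2*L)) (fun x hx => hx.2.1) ?_ κ0 (by rw [← hL, κL]; norm_num)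
    (by rw [hκ]; apply le_of_eq; field_simp; norm_num) ?_ M ?_
  · have hmain : ∫⁻ x in V', ‖G x - M‖ₑ^2 ≤ K * ∫⁻ x in Ω, e x := by
      refine (lintegral_mono_set hVb).trans (hM.trans (mul_le_mul_right (lintegral_mono_set ?_) _))
      intro z hz
      rw [mem_ball, dist_eq_norm] at hz
      have h1 := abs_le.1 (hrrl z p)
      rw [pr] at h1
      have h2 : ‖z‖ ≤ ‖z - p‖ + ‖p‖ := by simpa using norm_add_le (z - p) p
      refine (hch z (by linarith)).2 ?_
      have h3 : L * ‖z - p‖ ≤ L * (2 * (3*(κ*H))) := mul_le_mul_of_nonneg_left hz.le (by linarith)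
      have h4 : L * (2 * (3*(κ*H))) = 6 * (κ*L) * H := by ring
      rw [h4, κL] at h3
      linarith
    calc _ ≤ ∫⁻ x in V, ‖G x - M‖ₑ^2 := by
          refine lintegral_mono_set ?_
          rintro x ⟨h1, h2⟩
          rw [mem_ball, dist_zero_right] at h2
          have h3 := (hch x (by linarith)).1 h1
          refine ⟨(norm_proj12_le x).trans_lt h2, h3, ?_⟩
          have h4 := abs_le.1 (hrrl x 0)
          have h5 : rr ψ 0 = 0 := by simp [rr, proj12, hψ0]
          rw [h5, sub_zero, sub_zero] at h4
          nlinarith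
      _ ≤ ENNReal.ofReal (CA κ K) * (K * (∫⁻ x in Ω, e x) + ∫⁻ x in Ω, e x) :=
          key.trans (mul_le_mul_right (add_le_add_left hmain _) _)
      _ = _ := by
          rw [ENNReal.ofReal_mul (CA_nonneg κ0 K), ENNReal.ofReal_add K.coe_nonneg (by norm_num), ENNReal.ofReal_coe_nnreal, ENNReal.ofReal_one]
          ring
  · intro x hx z hz
    rw [mem_closedBall, dist_eq_norm] at hz
    have h0 := hVn x hx
    obtain ⟨h1, h2, h3⟩ := hx
    have h4 := abs_le.1 (hrrl z x)
    have h5 : ‖z‖ ≤ ‖z - x‖ + ‖x‖ := by simpa using norm_add_le (z - x) x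
    have h6 : L * ‖z - x‖ ≤ L * (1/(2*L) * rr ψ x) := mul_le_mul_of_nonneg_left hz (by linarith)
    have h7 : L * (1/(2*L) * rr ψ x) = rr ψ x / 2 := by field_simp
    rw [h7] at h6
    have h8 : ‖z - x‖ ≤ L * ‖z - x‖ := le_mul_of_one_le_left (norm_nonneg _) L1
    exact (hch z (by linarith)).2 (by linarith)
  · rintro x ⟨h1, h2, h3⟩
    have h4 := rr_PH ψ κ x
    have h5 : 0 < rr ψ (PH ψ κ x) := by rw [h4]; positivity
    by_cases h6 : rr ψ (PH ψ κ x) < H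
    · left; exact ⟨by rwa [proj12_PH], h5, h6⟩
    · right; exact ⟨by rwa [proj12_PH], not_lt.1 h6, by rw [h4]; gcongr⟩
  · refine fin_sub hG M ?_ (ne_top_of_le_ne_top hfin (lintegral_mono_set hVΩ))
    have : V ⊆ closedBall 0 ((1+κ)*H) := fun x hx => by simpa using hVn x hx
    exact ne_top_of_le_ne_top measure_closedBall_lt_top.ne (measure_mono this)

lemma iso_mp (φ : E3 ≃ᵢ E3) : MeasurePreserving φ volume volume := by
  have := φ.measurePreserving_euclideanHausdorffMeasure 3
  have e : (Measure.euclideanHausdorffMeasure 3 : Measure E3) = volume := by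
    have := InnerProductSpace.euclideanHausdorffMeasure_eq_volume (V := E3)
    simpa using this
  rwa [e] at this

lemma iso_lint (φ : E3 ≃ᵢ E3) (f : E3 → ENNReal) (A : Set E3) :
    ∫⁻ x in φ ⁻¹' A, f (φ x) = ∫⁻ x in A, f x :=
  (iso_mp φ).setLIntegral_comp_preimage_emb φ.toHomeomorph.measurableEmbedding f A

def Chart (Ω : Set E3) (E₀ r : ℝ) (P : E3) : Prop :=
  ∃ (φ : E3 ≃ᵢ E3) (ψ : E2 → ℝ), φ P = 0 ∧ ψ 0 = 0 ∧ (∀ x y, |ψ x - ψ y| ≤ E₀ * ‖x - y‖) ∧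
    ∀ x, dist x P < r → (x ∈ Ω ↔ 0 < rr ψ (φ x))

lemma chart_iso {Ω : Set E3} (hΩ : MeasurableSet Ω) {G : E3 → FM} (hG : Measurable G) {e : E3 → ENNReal} (he : Measurable e)
    {K : NNReal} (h : LK Ω G e K) (hfin : ∫⁻ x in Ω, ‖G x‖ₑ^2 ≠ ⊤)
    {E₀ r : ℝ} (hE : 0 ≤ E₀) (hr : 0 < r) {P : E3} (hP : Chart Ω E₀ r P) :
    ∃ M, ∫⁻ x in Ω ∩ ball P (r / (264 * (E₀+1)^2)), ‖G x - M‖ₑ^2 ≤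
      ENNReal.ofReal (CA (1/(66*(E₀+1))) K * (K+1)) * ∫⁻ x in Ω, e x := by
  obtain ⟨φ, ψ, h1, h2, h3, h4⟩ := hP
  have hm : Measurable φ.symm := φ.symm.continuous.measurable
  have hψc : Continuous ψ := by
    have : LipschitzWith (Real.toNNReal E₀) ψ := LipschitzWith.of_dist_le_mul (fun x y => by
      rw [Real.dist_eq, dist_eq_norm, Real.coe_toNNReal _ hE]; exact h3 x y)
    exact this.continuous
  have pb : ∀ x r, φ.symm ⁻¹' (ball x r) = ball (φ x) r := fun x r => by
    rw [IsometryEquiv.preimage_ball]; simp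
  have key := chart_std (Ω := φ.symm ⁻¹' Ω) (hm hΩ) (G := fun x => G (φ.symm x)) (hG.comp hm) (e := fun x => e (φ.symm x))
    (he.comp hm) (K := K) ?_ ?_ hE h3 h2 hψc hr ?_
  · obtain ⟨M, hM⟩ := key
    refine ⟨M, ?_⟩
    rw [iso_lint φ.symm e] at hM
    have e1 : φ.symm ⁻¹' Ω ∩ ball 0 (r / (264 * (E₀+1)^2)) = φ.symm ⁻¹' (Ω ∩ ball P (r / (264 * (E₀+1)^2))) := by
      rw [preimage_inter, pb, h1]
    rw [e1, iso_lint φ.symm (fun x => ‖G x - M‖ₑ^2)] at hM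
    exact hM
  · intro x ρ hρ hx
    obtain ⟨M, hM⟩ := h (φ.symm x) ρ hρ (by
      intro z hz
      have := @hx (φ z) (by
        rw [mem_closedBall] at hz ⊢
        rw [← φ.symm.dist_eq]; simpa using hz)
      simpa using this)
    refine ⟨M, ?_⟩
    have e1 : ∀ s, ball x s = φ.symm ⁻¹' (ball (φ.symm x) s) := fun s => by rw [pb]; simp
    rw [e1, e1, iso_lint φ.symm (fun x => ‖G x - M‖ₑ^2), iso_lint φ.symm e]
    exact hM
  · rw [iso_lint φ.symm (fun x => ‖G x‖ₑ^2)]; exact hfin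
  · intro x hx
    have := h4 (φ.symm x) (by
      rw [← φ.dist_eq, h1]; simpa using hx)
    simpa using this

lemma lh_open : IsOpen lowerHalf := isOpen_lt (coord_cd 2).continuous continuous_const

lemma closC_le {D₀ : ℝ} {C : Set E3} (h : ∀ x ∈ C, x 2 ≤ -D₀) : ∀ x ∈ closure C, x 2 ≤ -D₀ := by
  have : closure C ⊆ {x : E3 | x 2 ≤ -D₀} :=
    closure_minimal h (isClosed_le (coord_cd 2).continuous continuous_const)
  exact this

lemma coord2_close (x P : E3) {r : ℝ} (h : dist x P < r) : |x 2 - P 2| < r := by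
  rw [dist_eq_norm] at h
  have := abs2_le (x - P)
  have e : (x - P) 2 = x 2 - P 2 := by simp
  rw [e] at this; linarith

lemma charts {r₀ E₀ D₀ : ℝ} (hr₀ : 0 < r₀) (hE₀ : 0 < E₀) (hD₀ : 1 < D₀) {C : Set E3} (hC : IsLipschitzCavity r₀ E₀ D₀ C) :
    ∀ P ∈ frontier (lowerHalf \ closure C), Chart (lowerHalf \ closure C) E₀ (min r₀ (D₀/2)) P := by
  obtain ⟨⟨hCo, hCb, hCl, hconn, hCn, hCd, hdiam⟩, hLip⟩ := hC
  have hcl := closC_le hCd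
  have hΩo : IsOpen (lowerHalf \ closure C) := lh_open.sdiff isClosed_closure
  intro P hP
  have hP1 : P ∈ closure (lowerHalf \ closure C) := frontier_subset_closure hP
  have hP2 : P ∉ lowerHalf \ closure C := by
    rw [hΩo.frontier_eq] at hP; exact hP.2
  have hP3 : P 2 ≤ 0 := by
    have : closure (lowerHalf \ closure C) ⊆ {x : E3 | x 2 ≤ 0} :=
      closure_minimal (fun x hx => by have : x 2 < 0 := hx.1; exact this.le) (isClosed_le (coord_cd 2).continuous continuous_const)
    exact this hP1
  rcases hP3.eq_or_lt with h0 | h0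
  · refine ⟨IsometryEquiv.subRight P, fun _ => 0, by simp, rfl, fun x y => by simp; positivity, ?_⟩
    intro x hx
    have h1 := abs_lt.1 (coord2_close x P (hx.trans_le (min_le_right _ _)))
    have h2 : rr (fun _ => 0) (IsometryEquiv.subRight P x) = - x 2 := by
      simp [rr, h0]
    rw [h2]
    constructor
    · intro h; have : x 2 < 0 := h.1; linarith
    · intro h
      refine ⟨show x 2 < 0 by linarith, fun hx => ?_⟩
      have := hcl x hx
      linarith
  · have hPC : P ∈ closure C := by
      by_contra h; exact hP2 ⟨h0, h⟩
    have hPnC : P ∉ C := by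
      intro h
      obtain ⟨y, hy1, hy2⟩ := mem_closure_iff.1 hP1 C hCo h
      exact hy2.2 (subset_closure hy1)
    obtain ⟨φ, ψ₀, h1, h2, h3, h4⟩ := hLip P (by rw [hCo.frontier_eq]; exact ⟨hPC, hPnC⟩)
    obtain ⟨ψ, hψ1, hψ2⟩ := h3.extend_real
    have hψl : ∀ x y, |ψ x - ψ y| ≤ E₀ * ‖x - y‖ := fun x y => by
      have := hψ1.dist_le_mul x y
      rwa [Real.dist_eq, dist_eq_norm, Real.coe_toNNReal _ hE₀.le] at this
    have hψ0 : ψ 0 = 0 := by rw [← h2]; exact (hψ2 (by simpa using hr₀)).symm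
    have hC' : ∀ x, ‖φ x‖ < r₀ → (x ∈ C ↔ rr ψ (φ x) < 0) := by
      intro x hx
      have hb : φ x ∈ ball (0:E3) r₀ := by simpa using hx
      have e1 : ψ (proj12 (φ x)) = ψ₀ (proj12 (φ x)) :=
        (hψ2 (by simpa using (norm_proj12_le (φ x)).trans_lt hx)).symm
      have : φ x ∈ (φ '' C) ∩ ball 0 r₀ ↔ φ x ∈ {x ∈ ball (0 : E3) r₀ | ψ₀ (proj12 x) < x 2} := by rw [h4]
      rw [mem_inter_iff, φ.injective.mem_set_image] at this
      simp only [mem_ofPred_eq, hb, and_true, true_and] at this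
      rw [this, rr, e1, sub_neg]
    refine ⟨φ, ψ, h1, hψ0, hψl, ?_⟩
    intro x hx
    have hx1 := abs_lt.1 (coord2_close x P (hx.trans_le (min_le_right _ _)))
    have hx2 := hcl P hPC
    have hx3 : ‖φ x‖ < r₀ := by
      rw [← dist_zero_right, ← h1, φ.dist_eq]; exact hx.trans_le (min_le_left _ _)
    have hc : Continuous (fun y => rr ψ (φ y)) := (rr_cont hψ1.continuous).comp φ.continuous
    have hcn : Continuous (fun y => ‖φ y‖) := φ.continuous.norm
    constructor
    · intro h
      by_contra hn
      rw [not_lt] at hn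
      apply h.2
      rw [Metric.mem_closure_iff]
      intro ε hε
      obtain ⟨t, ht⟩ : ∃ t, t = min (ε/2) ((r₀ - ‖φ x‖)/2) := ⟨_, rfl⟩
      have t0 : 0 < t := by rw [ht]; exact lt_min (by linarith) (by linarith)
      have t1 : t ≤ ε/2 := by rw [ht]; exact min_le_left _ _
      have t2 : t ≤ (r₀ - ‖φ x‖)/2 := by rw [ht]; exact min_le_right _ _
      have nt : ‖t • ee 2‖ = t := by rw [norm_smul]; simp [ee, abs_of_pos t0]
      refine ⟨φ.symm (φ x + t • ee 2), (hC' _ ?_).2 ?_, ?_⟩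
      · have := norm_add_le (φ x) (t • ee 2)
        simp only [IsometryEquiv.apply_symm_apply]
        linarith
      · have e1 : rr ψ (φ x + t • ee 2) = rr ψ (φ x) - t := by
          have : proj12 (φ x + t • ee 2) = proj12 (φ x) := by simp [proj12, ee]
          rw [rr, this, rr]; simp [ee]; ring
        simp only [IsometryEquiv.apply_symm_apply]
        rw [e1]; linarith
      · rw [← φ.dist_eq, IsometryEquiv.apply_symm_apply, dist_self_add_right, nt]; linarith
    · intro h
      refine ⟨show x 2 < 0 by linarith, fun hxC => ?_⟩
      obtain ⟨y, hy1, hy2⟩ := mem_closure_iff.1 hxC _ ((isOpen_lt continuous_const hc).inter (isOpen_lt hcn continuous_const)) ⟨h, hx3⟩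
      have := (hC' y hy1.2).1 hy2
      have h5 : 0 < rr ψ (φ y) := hy1.1
      linarith

lemma ball_dich {Ω : Set E3} {q : E3} {r : ℝ} (h : ∀ P ∈ frontier Ω, P ∉ closedBall q r) :
    closedBall q r ⊆ Ω ∨ Disjoint (closedBall q r) Ω := by
  by_contra hn
  rw [not_or] at hn
  have hp : IsPreconnected (closedBall q r) := (convex_closedBall q r).isPreconnected
  obtain ⟨x, hx1, hx2⟩ := not_subset.1 hn.1
  obtain ⟨y, hy1, hy2⟩ := not_disjoint_iff.1 hn.2
  have hfr : ∀ w ∈ closedBall q r, w ∈ interior Ω ∨ w ∉ closure Ω := fun w hw => by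
    by_contra hc
    rw [not_or, not_not] at hc
    exact h w ⟨hc.2, hc.1⟩ hw
  obtain ⟨P, -, hP1, hP2⟩ := hp (interior Ω) (closure Ω)ᶜ isOpen_interior isClosed_closure.isOpen_compl hfr
    ⟨y, hy1, (hfr y hy1).resolve_right (not_not.2 (subset_closure hy2))⟩
    ⟨x, hx1, (hfr x hx1).resolve_left (fun hh => hx2 (interior_subset hh))⟩
  exact hP2 (interior_subset_closure hP1)

lemma local_korn {Ω : Set E3} (hΩ : MeasurableSet Ω) {G : E3 → FM} (hG : Measurable G) {e : E3 → ENNReal} (he : Measurable e)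
    {K : NNReal} (h : LK Ω G e K) (hfin : ∫⁻ x in Ω, ‖G x‖ₑ^2 ≠ ⊤)
    {E₀ r s : ℝ} (hE : 0 ≤ E₀) (hr : 0 < r) (hs : 0 < s) (hs1 : 10 * s ≤ r / (264 * (E₀+1)^2)) 
    (hch : ∀ P ∈ frontier Ω, Chart Ω E₀ r P) (q : E3) :
    ∃ M, ∫⁻ x in Ω ∩ ball q (2*s), ‖G x - M‖ₑ^2 ≤
      ENNReal.ofReal (CA (1/(66*(E₀+1))) K * (K+1) + K) * ∫⁻ x in Ω, e x := by
  have hCA := CA_nonneg (κ := 1/(66*(E₀+1))) (by positivity) K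
  have hK := K.coe_nonneg
  by_cases hq : ∀ P ∈ frontier Ω, P ∉ closedBall q (8*s)
  · rcases ball_dich hq with h1 | h1
    · obtain ⟨M, hM⟩ := h q (2*s) (by linarith) (by convert h1 using 2; ring)
      refine ⟨M, (lintegral_mono_set inter_subset_right).trans (hM.trans ?_)⟩
      refine mul_le_mul' ?_ (lintegral_mono_set ?_)
      · rw [← ENNReal.ofReal_coe_nnreal]
        exact ENNReal.ofReal_le_ofReal (by nlinarith [mul_nonneg hCA hK])
      · exact (ball_subset_closedBall.trans (closedBall_subset_closedBall (by linarith))).trans h1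
    · refine ⟨0, ?_⟩
      have : Ω ∩ ball q (2*s) = ∅ := by
        rw [← disjoint_iff_inter_eq_empty]
        exact (h1.mono_left (ball_subset_closedBall.trans (closedBall_subset_closedBall (by linarith)))).symm
      rw [this]; simp
  · push Not at hq
    obtain ⟨P, hP1, hP2⟩ := hq
    obtain ⟨M, hM⟩ := chart_iso hΩ hG he h hfin hE hr (hch P hP1)
    refine ⟨M, le_trans (lintegral_mono_set ?_) (hM.trans ?_)⟩
    · refine inter_subset_inter_right _ (ball_subset_ball' ?_)
      rw [mem_closedBall, dist_comm] at hP2; linarith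
    · exact mul_le_mul_left (ENNReal.ofReal_le_ofReal (by linarith)) _

lemma int_ball {Ω : Set E3} {E₀ r s : ℝ} (hE : 0 ≤ E₀) (hs : 0 < s) (hs1 : s ≤ r)
    (hch : ∀ P ∈ frontier Ω, Chart Ω E₀ r P) {z : E3} (hz : z ∈ Ω) :
    ∃ p, ball p (s/(8*(E₀+1))) ⊆ Ω ∩ ball z s := by
  have hd : s/(8*(E₀+1)) ≤ s/8 := by
    refine div_le_div_of_nonneg_left hs.le (by norm_num) (by linarith)
  by_cases hq : ∀ P ∈ frontier Ω, P ∉ closedBall z (s/4)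
  · refine ⟨z, subset_inter ?_ (ball_subset_ball (by linarith))⟩
    rcases ball_dich hq with h1 | h1
    · exact (ball_subset_closedBall.trans (closedBall_subset_closedBall (by linarith))).trans h1
    · exact absurd hz (disjoint_left.1 h1 (mem_closedBall_self (by linarith)))
  · push Not at hq
    obtain ⟨P, hP1, hP2⟩ := hq
    obtain ⟨φ, ψ, h1, h2, h3, h4⟩ := hch P hP1
    have hrrl := rr_lip hE h3
    rw [mem_closedBall, dist_comm] at hP2
    have hz1 := (h4 z (by linarith)).1 hz
    have nt : ‖(s/4) • ee 2‖ = s/4 := by rw [norm_smul]; simp [ee, abs_of_pos hs]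
    refine ⟨φ.symm (φ z - (s/4) • ee 2), fun x hx => ?_⟩
    rw [mem_ball, ← φ.dist_eq, IsometryEquiv.apply_symm_apply] at hx
    have d1 : dist (φ z - (s/4) • ee 2) (φ z) = s/4 := by
      rw [dist_eq_norm, sub_sub_cancel_left, norm_neg, nt]
    have d2 : dist x z < s/8 + s/4 := by
      rw [← φ.dist_eq]
      have := dist_triangle (φ x) (φ z - (s/4) • ee 2) (φ z)
      linarith
    refine ⟨(h4 x ?_).2 ?_, by rw [mem_ball]; linarith⟩
    · have := dist_triangle x z P; linarith
    · have e1 : rr ψ (φ z - (s/4) • ee 2) = rr ψ (φ z) + s/4 := by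
        have : proj12 (φ z - (s/4) • ee 2) = proj12 (φ z) := by simp [proj12, ee]
        rw [rr, this, rr]; simp [ee]; ring
      have h5 := abs_le.1 (hrrl (φ x) (φ z - (s/4) • ee 2))
      rw [dist_eq_norm] at hx
      have h6 : (E₀+1) * ‖φ x - (φ z - (s/4) • ee 2)‖ ≤ (E₀+1) * (s/(8*(E₀+1))) := mul_le_mul_of_nonneg_left hx.le (by linarith)
      have h7 : (E₀+1) * (s/(8*(E₀+1))) = s/8 := by field_simp
      linarith

lemma chain {ι : Type} [Fintype ι] {Ω : Set E3} (hΩ : IsPreconnected Ω) (W : ι → Set E3) (hWo : ∀ i, IsOpen (W i))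
    (hcov : Ω ⊆ ⋃ i, W i) (hWΩ : ∀ i, W i ⊆ Ω) (M : ι → FM) {b : ℝ} (hb : 0 ≤ b) (o : ι) (ho : (W o).Nonempty) (hMo : M o = 0)
    (hadj : ∀ i j, (W i ∩ W j).Nonempty → ‖M i - M j‖ ≤ b) (i : ι) (hi : (W i).Nonempty) :
    ‖M i‖ ≤ Fintype.card ι * b := by
  let Gr : SimpleGraph ι := ⟨fun i j => i ≠ j ∧ (W i ∩ W j).Nonempty, ⟨fun i j h => ⟨h.1.symm, by rw [inter_comm]; exact h.2⟩⟩, ⟨fun i h => h.1 rfl⟩⟩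
  have hwalk : ∀ {j k : ι} (p : Gr.Walk j k), ‖M j - M k‖ ≤ p.length * b := by
    intro j k p
    induction p with
    | nil => simp
    | @cons x y z h p ih =>
      rw [SimpleGraph.Walk.length_cons]; push_cast
      have h1 := hadj x y h.2
      have h2 := norm_sub_le_norm_sub_add_norm_sub (M x) (M y) (M z)
      linarith
  have hreach : Gr.Reachable i o := by
    by_contra hn
    obtain ⟨z, hz, hz1, hz2⟩ := hΩ (⋃ j ∈ {j | Gr.Reachable j o}, W j) (⋃ j ∈ {j | ¬ Gr.Reachable j o}, W j)
      (isOpen_biUnion fun j _ => hWo j) (isOpen_biUnion fun j _ => hWo j)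
      (by
        intro z hz
        obtain ⟨j, hj⟩ := mem_iUnion.1 (hcov hz)
        by_cases h : Gr.Reachable j o
        · left; exact mem_biUnion h hj
        · right; exact mem_biUnion h hj)
      (by
        obtain ⟨z, hz⟩ := ho
        exact ⟨z, hWΩ _ hz, mem_biUnion (show o ∈ {j | Gr.Reachable j o} from SimpleGraph.Reachable.refl _) hz⟩)
      (by
        obtain ⟨z, hz⟩ := hi
        exact ⟨z, hWΩ _ hz, mem_biUnion (show i ∈ {j | ¬ Gr.Reachable j o} from hn) hz⟩)
    rw [mem_iUnion₂] at hz1 hz2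
    obtain ⟨j, hj, hj'⟩ := hz1
    obtain ⟨k, hk, hk'⟩ := hz2
    have hj : Gr.Reachable j o := hj
    have hk : ¬ Gr.Reachable k o := hk
    apply hk
    by_cases hjk : k = j
    · rw [hjk]; exact hj
    · have : Gr.Adj k j := ⟨hjk, z, hk', hj'⟩
      exact this.reachable.trans hj
  obtain ⟨p, hp⟩ := hreach.exists_isPath
  have h1 := hwalk p
  rw [hMo, sub_zero] at h1
  have h2 : (p.length : ℝ) ≤ Fintype.card ι := by exact_mod_cast hp.length_lt.le
  exact h1.trans (mul_le_mul_of_nonneg_right h2 hb)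

lemma glue {ι : Type} [Fintype ι] {Ω : Set E3} (hΩ : IsPreconnected Ω) {G : E3 → FM} (hG : Measurable G)
    (W U : ι → Set E3) (hWo : ∀ i, IsOpen (W i))
    (hcov : Ω ⊆ ⋃ i, W i) (hWΩ : ∀ i, W i ⊆ Ω) {s δ : ℝ} (hs : 0 < s) (hδ : 0 < δ) (hU : ∀ i, ∀ z ∈ W i, Ω ∩ ball z s ⊆ U i)
    (hib : ∀ z ∈ Ω, ∃ p, ball p δ ⊆ Ω ∩ ball z s) (M : ι → FM) (o : ι) (ho : (W o).Nonempty) (hMo : M o = 0)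
    (A : NNReal) (hA : ∀ i, ∫⁻ x in U i, ‖G x - M i‖ₑ^2 ≤ A) {v : ℝ} (hv : 0 < v) (hvv : ∀ p : E3, volume (ball p δ) = ENNReal.ofReal v)
    {v2 : ENNReal} (hv2 : ∀ i, i ≠ o → volume (W i) ≤ v2) :
    ∫⁻ x in Ω, ‖G x‖ₑ^2 ≤ (Fintype.card ι * (2 + 2 * (ENNReal.ofReal ((Fintype.card ι)^2 * 4 / v) * v2))) * A := by
  set N := Fintype.card ι
  have hA0 := A.coe_nonneg
  have hadj : ∀ i j, (W i ∩ W j).Nonempty → ‖M i - M j‖ ≤ √(4 * A / v) := by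
    rintro i j ⟨z, hz1, hz2⟩
    obtain ⟨p, hp⟩ := hib z (hWΩ _ hz1)
    have h1 : ∫⁻ x in ball p δ, ‖G x - M i‖ₑ^2 ≤ A := (lintegral_mono_set (hp.trans (hU i z hz1))).trans (hA i)
    have h2 : ∫⁻ x in ball p δ, ‖G x - M j‖ₑ^2 ≤ A := (lintegral_mono_set (hp.trans (hU j z hz2))).trans (hA j)
    have h3 : ∫⁻ x in ball p δ, ‖M i - M j‖ₑ^2 ≤ ∫⁻ x in ball p δ, (2 * ‖G x - M i‖ₑ^2 + 2 * ‖G x - M j‖ₑ^2) := by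
      refine lintegral_mono (fun x => ?_)
      have := enorm_sq_tri (M i) (G x) (M j)
      rwa [enorm_sub_rev (M i) (G x), enorm_sub_rev (M j) (G x)] at this
    rw [lintegral_const, Measure.restrict_apply_univ, hvv, lintegral_add_left (by fun_prop), lintegral_const_mul _ (by fun_prop), lintegral_const_mul _ (by fun_prop), esq] at h3
    have h4 : ENNReal.ofReal (‖M i - M j‖^2) * ENNReal.ofReal v ≤ ENNReal.ofReal (4 * A) := by
      refine h3.trans ((add_le_add (mul_le_mul_right h1 _) (mul_le_mul_right h2 _)).trans_eq ?_)
      rw [ENNReal.ofReal_mul (by norm_num), ENNReal.ofReal_coe_nnreal, show ENNReal.ofReal 4 = 4 by norm_num]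
      ring
    rw [← ENNReal.ofReal_mul (by positivity), ENNReal.ofReal_le_ofReal_iff (by positivity)] at h4
    refine Real.le_sqrt_of_sq_le ?_
    rw [le_div_iff₀ hv]; exact h4
  have hM : ∀ i, (W i).Nonempty → ‖M i‖ₑ^2 ≤ ENNReal.ofReal (N^2 * 4 / v) * A := by
    intro i hi
    have h1 := chain hΩ W hWo hcov hWΩ M (Real.sqrt_nonneg _) o ho hMo hadj i hi
    rw [esq, ← ENNReal.ofReal_coe_nnreal (p := A), ← ENNReal.ofReal_mul (by positivity)]
    apply ENNReal.ofReal_le_ofReal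
    have h2 : ‖M i‖^2 ≤ (N * √(4 * A / v))^2 := pow_le_pow_left₀ (norm_nonneg _) h1 2
    rw [mul_pow, Real.sq_sqrt (by positivity)] at h2
    refine h2.trans_eq ?_
    ring
  have hW : ∀ i, ∫⁻ x in W i, ‖G x‖ₑ^2 ≤ (2 + 2 * (ENNReal.ofReal (N^2 * 4 / v) * v2)) * A := by
    intro i
    have hWU : W i ⊆ U i := fun z hz => hU i z hz ⟨hWΩ i hz, mem_ball_self hs⟩
    have h1 : ∫⁻ x in W i, ‖G x - M i‖ₑ^2 ≤ A := (lintegral_mono_set hWU).trans (hA i)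
    rcases (W i).eq_empty_or_nonempty with he | hne
    · rw [he]; simp
    by_cases hio : i = o
    · rw [hio, hMo] at h1
      simp only [sub_zero] at h1
      rw [hio]
      refine h1.trans ?_
      refine le_mul_of_one_le_left zero_le ?_
      exact le_add_right (by norm_num)
    · calc ∫⁻ x in W i, ‖G x‖ₑ^2 ≤ ∫⁻ x in W i, (2 * ‖G x - M i‖ₑ^2 + 2 * ‖M i‖ₑ^2) := 
            lintegral_mono (fun x => by simpa using enorm_sq_tri (G x) (M i) 0)
        _ = 2 * (∫⁻ x in W i, ‖G x - M i‖ₑ^2) + 2 * ‖M i‖ₑ^2 * volume (W i) := by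
            rw [lintegral_add_left (by fun_prop), lintegral_const_mul _ (by fun_prop), lintegral_const, Measure.restrict_apply_univ]
        _ ≤ 2 * A + 2 * (ENNReal.ofReal (N^2 * 4 / v) * A) * v2 := by
            gcongr
            · exact hM i hne
            · exact hv2 i hio
        _ = _ := by ring
  calc ∫⁻ x in Ω, ‖G x‖ₑ^2 ≤ ∫⁻ x in ⋃ i, W i, ‖G x‖ₑ^2 := lintegral_mono_set hcov
    _ ≤ ∑' i, ∫⁻ x in W i, ‖G x‖ₑ^2 := lintegral_iUnion_le _ _
    _ = ∑ i, ∫⁻ x in W i, ‖G x‖ₑ^2 := tsum_fintype _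
    _ ≤ ∑ i : ι, (2 + 2 * (ENNReal.ofReal (N^2 * 4 / v) * v2)) * A := Finset.sum_le_sum (fun i _ => hW i)
    _ = _ := by rw [Finset.sum_const, nsmul_eq_mul, Finset.card_univ, mul_assoc]

lemma frob2_nonneg (M : Matrix (Fin 3) (Fin 3) ℝ) : 0 ≤ frob2 M := by unfold frob2; positivity

lemma frob2_strain_le (u : E3 → E3) (x : E3) : frob2 (strain u x) ≤ frob2 (jac u x) := by
  unfold frob2 strain
  simp only [Fin.sum_univ_three]
  nlinarith [sq_nonneg (jac u x 0 1 - jac u x 1 0), sq_nonneg (jac u x 0 2 - jac u x 2 0), sq_nonneg (jac u x 1 2 - jac u x 2 1)]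

lemma korn_lint (r₀ E₀ D₀ : ℝ) (hr₀ : 0 < r₀) (hE₀ : 0 < E₀) (hD₀ : 1 < D₀) :
    ∃ c : ENNReal, c ≠ ⊤ ∧ ∀ C : Set E3, IsLipschitzCavity r₀ E₀ D₀ C → ∀ u : E3 → E3, ContDiffOn ℝ 1 u (lowerHalf \ closure C) →
      ∫⁻ x in lowerHalf \ closure C, ‖GG u x‖ₑ^2 ≠ ⊤ → ∫⁻ x in lowerHalf \ closure C, eS u x ≠ ⊤ →
      ∫⁻ x in lowerHalf \ closure C, ‖GG u x‖ₑ^2 ≤ c * ∫⁻ x in lowerHalf \ closure C, eS u x := by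
  obtain ⟨K, hK⟩ := LK_korn
  obtain ⟨r, hr⟩ : ∃ r, r = min r₀ (D₀/2) := ⟨_, rfl⟩
  have r0 : 0 < r := by rw [hr]; exact lt_min hr₀ (by linarith)
  obtain ⟨s, hs⟩ : ∃ s, s = r / (264 * (E₀+1)^2) / 10 := ⟨_, rfl⟩
  have s0 : 0 < s := by rw [hs]; positivity
  have s1 : 10 * s ≤ r / (264 * (E₀+1)^2) := by rw [hs]; linarith
  have s2 : s ≤ r := by
    have : r / (264 * (E₀+1)^2) ≤ r := div_le_self r0.le (by nlinarith)
    linarith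
  obtain ⟨δ, hδ⟩ : ∃ δ, δ = s/(8*(E₀+1)) := ⟨_, rfl⟩
  have δ0 : 0 < δ := by rw [hδ]; positivity
  obtain ⟨t, -, htf, htc⟩ := (isCompact_closedBall (0:E3) (4*D₀+s)).finite_cover_balls s0
  haveI : Fintype t := htf.fintype
  have vf : volume (ball (0:E3) 1) ≠ ⊤ := measure_ball_lt_top.ne
  have v0 : 0 < (volume (ball (0:E3) 1)).toReal := ENNReal.toReal_pos (measure_ball_pos volume _ one_pos).ne' vf
  have hvb : ∀ (p : E3) {ρ : ℝ}, 0 < ρ → volume (ball p ρ) = ENNReal.ofReal (ρ^3 * (volume (ball (0:E3) 1)).toReal) := fun p ρ hρ => by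
    rw [vol_ball p hρ, ENNReal.ofReal_mul (by positivity), ENNReal.ofReal_toReal vf]
  set v := δ^3 * (volume (ball (0:E3) 1)).toReal
  set v2 := ENNReal.ofReal (s^3 * (volume (ball (0:E3) 1)).toReal)
  set C1 := CA (1/(66*(E₀+1))) K * (K+1) + K
  set C2 := CA (1/132) K
  have C10 : 0 ≤ C1 := by
    have := CA_nonneg (κ := 1/(66*(E₀+1))) (by positivity) K
    have := K.coe_nonneg
    positivity
  have C20 : 0 ≤ C2 := CA_nonneg (by norm_num) K
  refine ⟨(Fintype.card (Option t) * (2 + 2 * (ENNReal.ofReal ((Fintype.card (Option t))^2 * 4 / v) * v2))) * ENNReal.ofReal (C1 + C2), ?_, ?_⟩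
  · refine ENNReal.mul_ne_top (ENNReal.mul_ne_top (by simp) (ENNReal.add_ne_top.2 ⟨by simp, ENNReal.mul_ne_top (by simp) (ENNReal.mul_ne_top ENNReal.ofReal_ne_top ENNReal.ofReal_ne_top)⟩)) ENNReal.ofReal_ne_top
  intro C hC u hu hfin hefin
  have hch := charts hr₀ hE₀ hD₀ hC
  rw [← hr] at hch
  obtain ⟨⟨hCo, hCb, hCl, hconn, hCn, hCd, hdiam⟩, -⟩ := hC
  have hΩo : IsOpen (lowerHalf \ closure C) := lh_open.sdiff isClosed_closure
  have hΩs : lowerHalf \ closure C ⊆ lowerHalf := fun x hx => hx.1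
  have hΩR : ∀ x : E3, x 2 < 0 → 3/4 * (4*D₀) < ‖x‖ → x ∈ lowerHalf \ closure C := by
    intro x h1 h2
    refine ⟨h1, fun h3 => ?_⟩
    have : closure C ⊆ closedBall 0 (2*D₀) := closure_minimal (fun y hy => by
      have : ‖y‖ < 2*D₀ := (hCn hy).1
      simpa using this.le) isClosed_closedBall
    have := this h3
    rw [mem_closedBall, dist_zero_right] at this
    linarith
  generalize lowerHalf \ closure C = Ω at *
  have hLK := hK Ω u hΩo hu
  have hG := GG_meas u
  have he := eS_meas u
  generalize GG u = G at *
  generalize eS u = e at *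
  have hfar := far (R := 4*D₀) (by linarith) hΩo.measurableSet hΩs hΩR hG he hLK hfin
  have hloc := local_korn hΩo.measurableSet hG he hLK hfin hE₀.le r0 s0 s1 hch
  have hib := fun z (hz : z ∈ Ω) => int_ball hE₀.le s0 s2 hch hz
  rw [← hδ] at hib
  choose Mq hMq using hloc
  set E := ∫⁻ x in Ω, e x
  have hAf : ENNReal.ofReal (C1 + C2) * E ≠ ⊤ := ENNReal.mul_ne_top ENNReal.ofReal_ne_top hefin
  let W : Option t → Set E3 := fun i => i.elim (Ω \ closedBall 0 (4*D₀+s)) (fun q => Ω ∩ ball q s)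
  let U : Option t → Set E3 := fun i => i.elim (Ω \ closedBall 0 (4*D₀)) (fun q => Ω ∩ ball q (2*s))
  let M : Option t → FM := fun i => i.elim 0 (fun q => Mq q)
  have key := glue (ι := Option t) hconn.isPreconnected hG W U ?_ ?_ ?_ s0 δ0 ?_ hib M none ?_ rfl (ENNReal.ofReal (C1 + C2) * E).toNNReal ?_
    (v := v) (by positivity) (fun p => hvb p δ0) (v2 := v2) ?_
  · rw [ENNReal.coe_toNNReal hAf, ← mul_assoc] at key
    exact key
  · rintro (_ | q)
    · exact hΩo.sdiff isClosed_closedBall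
    · exact hΩo.inter isOpen_ball
  · intro x hx
    by_cases h1 : x ∈ closedBall (0:E3) (4*D₀+s)
    · obtain ⟨q, hq, hq'⟩ := mem_iUnion₂.1 (htc h1)
      exact mem_iUnion.2 ⟨some ⟨q, hq⟩, hx, hq'⟩
    · exact mem_iUnion.2 ⟨none, hx, h1⟩
  · rintro (_ | q)
    · exact fun x hx => hx.1
    · exact fun x hx => hx.1
  · rintro (_ | q) z hz x hx
    · refine ⟨hx.1, fun h => ?_⟩
      have h1 := hz.2
      have h2 := hx.2
      rw [mem_closedBall] at h1 h
      rw [mem_ball, dist_comm] at h2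
      have := dist_triangle z x 0
      linarith
    · refine ⟨hx.1, ?_⟩
      have h1 := hz.2
      have h2 := hx.2
      rw [mem_ball] at h1 h2 ⊢
      have := dist_triangle x z q
      linarith
  · have n1 : ‖-((4*D₀+s+1) • ee 2)‖ = 4*D₀+s+1 := by
      rw [norm_neg, norm_smul, Real.norm_eq_abs, abs_of_pos (by linarith)]; simp [ee]
    refine ⟨-((4*D₀+s+1) • ee 2), hΩR _ (by simp [ee]; linarith) (by rw [n1]; linarith), ?_⟩
    rw [mem_closedBall, dist_zero_right, n1]; linarith
  · rw [ENNReal.coe_toNNReal hAf]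
    rintro (_ | q)
    · have : ∫⁻ x in Ω \ closedBall 0 (4*D₀), ‖G x - 0‖ₑ^2 ≤ ENNReal.ofReal (C1 + C2) * E := by
        simp only [sub_zero]
        exact hfar.trans (mul_le_mul_left (ENNReal.ofReal_le_ofReal (by linarith)) _)
      exact this
    · exact (hMq q).trans (mul_le_mul_left (ENNReal.ofReal_le_ofReal (by linarith)) _)
  · rintro (_ | q) hi
    · exact absurd rfl hi
    · exact (measure_mono inter_subset_right).trans_eq (hvb _ s0)

theorem korn_inequality (r₀ E₀ D₀ : ℝ) (hr₀ : 0 < r₀) (hE₀ : 0 < E₀) (hD₀ : 1 < D₀) :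
    ∃ c : ℝ, 0 < c ∧ ∀ C : Set E3, IsLipschitzCavity r₀ E₀ D₀ C →
      ∀ u : E3 → E3, ContDiffOn ℝ 1 u (lowerHalf \ closure C) →
      IntegrableOn (fun x => ‖u x‖^2 / (1 + ‖x‖^2)) (lowerHalf \ closure C) →
      IntegrableOn (fun x => frob2 (jac u x)) (lowerHalf \ closure C) →
      (∫ x in lowerHalf \ closure C, frob2 (jac u x)) ≤
        c * ∫ x in lowerHalf \ closure C, frob2 (strain u x) := by
  obtain ⟨c, hc, h⟩ := korn_lint r₀ E₀ D₀ hr₀ hE₀ hD₀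
  refine ⟨c.toReal + 1, by positivity, ?_⟩
  intro C hC u hu _ hj
  have h1 := h C hC u hu
  have hjf : ∫⁻ x in lowerHalf \ closure C, ENNReal.ofReal (frob2 (jac u x)) ≠ ⊤ :=
    (hj.lintegral_lt_top).ne
  have hle : ∫⁻ x in lowerHalf \ closure C, eS u x ≤ ∫⁻ x in lowerHalf \ closure C, ENNReal.ofReal (frob2 (jac u x)) :=
    lintegral_mono (fun x => ENNReal.ofReal_le_ofReal (frob2_strain_le u x))
  simp only [GG_norm] at h1
  have hef := ne_top_of_le_ne_top hjf hle
  have h2 := h1 hjf hef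
  rw [integral_eq_lintegral_of_nonneg_ae (Filter.Eventually.of_forall (fun x => frob2_nonneg _)) hj.aestronglyMeasurable,
    integral_eq_lintegral_of_nonneg_ae (Filter.Eventually.of_forall (fun x => frob2_nonneg _)) (strain_meas u).aestronglyMeasurable]
  have h3 := ENNReal.toReal_mono (ENNReal.mul_ne_top hc hef) h2
  rw [ENNReal.toReal_mul] at h3
  refine h3.trans ?_
  exact mul_le_mul_of_nonneg_right (by linarith) ENNReal.toReal_nonneg
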